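/- arXiv:2107.05182 — 8 statements merged into one kernel-verified Lean document; each statement's English description precedes it below -/
import Mathlib

section
/- Let p > 1 and suppose C₁, C_{1/2} > 0 are constants such that for every Schwartz function v : ℝ → ℂ one has ∫_ℝ|v|^{p+1} ≤ C₁ (∫_ℝ|v|²)^{(p+3)/4} (∫_ℝ|v′|²)^{(p−1)/4} and ∫_ℝ|v|^{p+1} ≤ C_{1/2} (∫_ℝ|v|²) (∫_ℝ 2π|ξ| |v̂(ξ)|² dξ)^{(p−1)/2}. Set C_GN = 2^{(3p−1)/2} max{C₁, C_{1/2}}. Then for every c ≥ 1, every δ ∈ (0,1], and every Schwartz function u : ℝ → ℂ, ∫_ℝ|u|^{p+1} ≤ C_GN · { (∫_ℝ|u|²)^{(p+3)/4} (∫_{2π|ξ|≤cδ} m_c(2πξ)|û(ξ)|² dξ)^{(p−1)/4} + (cδ)^{−(p−1)/2} (∫_ℝ|u|²) (∫_{2π|ξ|>cδ} m_c(2πξ)|û(ξ)|² dξ)^{(p−1)/2} }. -/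
open Real MeasureTheory SchwartzMap FourierTransform

/-- The symbol of the pseudo-relativistic operator. -/
noncomputable def mSym (c ξ : ℝ) : ℝ := Real.sqrt (c ^ 2 * ξ ^ 2 + c ^ 4 / 4) - c ^ 2 / 2

lemma mSym_low (c η : ℝ) (h : |η| ≤ c) : η ^ 2 ≤ 2 * mSym c η := by
  have hc : 0 ≤ c := (abs_nonneg η).trans h
  have h2 : η ^ 2 ≤ c ^ 2 := sq_le_sq.2 (by rwa [abs_of_nonneg hc])
  have : η ^ 2 / 2 + c ^ 2 / 2 ≤ Real.sqrt (c ^ 2 * η ^ 2 + c ^ 4 / 4) := by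
    apply Real.le_sqrt_of_sq_le
    nlinarith [sq_nonneg η, sq_nonneg c]
  unfold mSym
  linarith

lemma mSym_high (c δ η : ℝ) (hc : 0 < c) (hδ : 0 < δ) (hδ1 : δ ≤ 1) (h : c * δ ≤ |η|) :
    c * δ * |η| ≤ 2 * mSym c η := by
  have : c * δ * |η| / 2 + c ^ 2 / 2 ≤ Real.sqrt (c ^ 2 * η ^ 2 + c ^ 4 / 4) := by
    apply Real.le_sqrt_of_sq_le
    rw [← sq_abs η]
    have h0 := abs_nonneg η
    generalize |η| = t at *
    have h1 : c ^ 2 * (c * δ * t) ≤ c ^ 2 * (t * t) := by gcongr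
    have h2 : (c * t) ^ 2 * δ ^ 2 ≤ (c * t) ^ 2 * 1 := by
      gcongr; nlinarith
    nlinarith [sq_nonneg (c * t)]
  unfold mSym
  linarith

lemma mSym_nonneg (c η : ℝ) : 0 ≤ mSym c η := by
  have : c ^ 2 / 2 ≤ Real.sqrt (c ^ 2 * η ^ 2 + c ^ 4 / 4) := by
    apply Real.le_sqrt_of_sq_le
    nlinarith [sq_nonneg (c * η)]
  unfold mSym
  linarith

lemma mSym_le (c η : ℝ) (hc : 0 < c) : mSym c η ≤ c * |η| := by
  have : Real.sqrt (c ^ 2 * η ^ 2 + c ^ 4 / 4) ≤ c * |η| + c ^ 2 / 2 := by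
    apply Real.sqrt_le_iff.2 ⟨by positivity, ?_⟩
    rw [← sq_abs η]
    have h0 := abs_nonneg η
    generalize |η| = t at *
    have : 0 ≤ c ^ 3 * t := by positivity
    nlinarith
  unfold mSym
  linarith

lemma continuous_mSym (c : ℝ) : Continuous (mSym c) := by
  unfold mSym; fun_prop

lemma schwartz_int_sq (f : SchwartzMap ℝ ℂ) (k : ℕ) :
    Integrable (fun ξ : ℝ => |ξ| ^ k * ‖f ξ‖ ^ 2) := by
  obtain ⟨C, hC⟩ := f.decay 0 0
  have h := f.integrable_pow_mul volume k
  refine (h.mul_bdd (c := C) (g := fun ξ => ‖f ξ‖) f.continuous.norm.aestronglyMeasurable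
    (Filter.Eventually.of_forall fun x => ?_)).congr (Filter.Eventually.of_forall fun x => ?_)
  · simpa using hC.2 x
  · simp only [Real.norm_eq_abs]; ring

lemma schwartz_int_rpow (f : SchwartzMap ℝ ℂ) (q : ℝ) (hq : 0 < q) :
    Integrable (fun ξ : ℝ => ‖f ξ‖ ^ q) := by
  have := (f.memLp (ENNReal.ofReal q)).integrable_norm_rpow (by simpa using hq) (by simp)
  simpa [ENNReal.toReal_ofReal hq.le] using this

lemma schwartz_int_mSym (f : SchwartzMap ℝ ℂ) (c : ℝ) (hc : 0 < c) :
    Integrable (fun ξ : ℝ => mSym c (2 * π * ξ) * ‖f ξ‖ ^ 2) := by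
  refine ((schwartz_int_sq f 1).const_mul (c * (2 * π))).mono' ?_
    (Filter.Eventually.of_forall fun x => ?_)
  · have := f.continuous
    have := continuous_mSym c
    exact Continuous.aestronglyMeasurable (by fun_prop)
  · rw [Real.norm_of_nonneg (mul_nonneg (mSym_nonneg _ _) (by positivity))]
    have := mSym_le c (2 * π * x) hc
    rw [abs_mul, abs_of_pos (by positivity : 0 < 2 * π)] at this
    calc _ ≤ c * (2 * π * |x|) * ‖f x‖ ^ 2 := by gcongr
      _ = _ := by ring

lemma deriv_plancherel (v : SchwartzMap ℝ ℂ) :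
    ∫ x : ℝ, ‖deriv (⇑v) x‖ ^ 2 = ∫ ξ : ℝ, (2 * π * ξ) ^ 2 * ‖𝓕 (⇑v) ξ‖ ^ 2 := by
  have h := (SchwartzMap.derivCLM ℂ ℂ v).integral_norm_sq_fourier
  simp only [SchwartzMap.derivCLM_apply] at h
  rw [← h]
  congr 1
  ext ξ
  rw [SchwartzMap.fourier_coe]
  have : (⇑(SchwartzMap.derivCLM ℂ ℂ v) : ℝ → ℂ) = deriv v := by
    ext x; simp
  rw [this, Real.fourier_deriv v.integrable v.differentiable
    (by rw [← this]; exact SchwartzMap.integrable _)]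
  simp only [norm_smul, norm_mul, mul_pow, Complex.norm_real, Complex.norm_I]
  simp

/-- Splitting with a bump. -/
lemma split_bump (u : SchwartzMap ℝ ℂ) (f : ContDiffBump (0 : ℝ)) :
    ∃ v w : SchwartzMap ℝ ℂ, (∀ x, u x = v x + w x) ∧
      (∀ ξ, 𝓕 (⇑v) ξ = (f ξ : ℂ) * 𝓕 (⇑u) ξ) ∧
      (∀ ξ, 𝓕 (⇑w) ξ = (1 - (f ξ : ℂ)) * 𝓕 (⇑u) ξ) := by
  have hcs : HasCompactSupport (fun ξ : ℝ => (f ξ : ℂ) * (𝓕 u) ξ) := by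
    apply HasCompactSupport.mul_right
    exact f.hasCompactSupport.comp_left (g := fun t : ℝ => (t : ℂ)) (by simp)
  have hsm : ContDiff ℝ (⊤ : ℕ∞) (fun ξ : ℝ => (f ξ : ℂ) * (𝓕 u) ξ) := by
    apply ContDiff.mul
    · exact Complex.ofRealCLM.contDiff.comp f.contDiff
    · exact SchwartzMap.smooth _ _
  let g : SchwartzMap ℝ ℂ := hcs.toSchwartzMap hsm
  have hv : ∀ ξ, 𝓕 (⇑(𝓕⁻ g : SchwartzMap ℝ ℂ)) ξ = (f ξ : ℂ) * 𝓕 (⇑u) ξ := by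
    intro ξ
    rw [← SchwartzMap.fourier_coe, FourierTransform.fourier_fourierInv_eq]
    rfl
  refine ⟨𝓕⁻ g, u - 𝓕⁻ g, fun x => by simp, hv, fun ξ => ?_⟩
  have : 𝓕 (⇑(u - 𝓕⁻ g)) ξ = 𝓕 (⇑u) ξ - 𝓕 (⇑(𝓕⁻ g : SchwartzMap ℝ ℂ)) ξ := by
    rw [← SchwartzMap.fourier_coe, ← SchwartzMap.fourier_coe, ← SchwartzMap.fourier_coe]
    rw [← sub_apply]
    congr 1
    simp only [sub_eq_add_neg, FourierTransform.fourier_add]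
    congr 1
    exact FourierTransform.fourier_neg _
  rw [this, hv]; ring

lemma rpow_add_aux (a b p : ℝ) (ha : 0 ≤ a) (hb : 0 ≤ b) (hp : 0 ≤ p) :
    (a + b) ^ (p + 1) ≤ 2 ^ p * (a ^ (p + 1) + b ^ (p + 1)) := by
  have := NNReal.rpow_add_le_mul_rpow_add_rpow ⟨a, ha⟩ ⟨b, hb⟩ (p := p + 1) (by linarith)
  rw [add_sub_cancel_right] at this
  exact_mod_cast this

lemma bump_ineq (p : ℝ) (hp : 1 < p)
    (C₁ Chalf : ℝ) (hC₁ : 0 < C₁) (hChalf : 0 < Chalf)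
    (hGN1 : ∀ v : SchwartzMap ℝ ℂ,
      (∫ x : ℝ, ‖v x‖ ^ (p + 1))
        ≤ C₁ * (∫ x : ℝ, ‖v x‖ ^ 2) ^ ((p + 3) / 4)
            * (∫ x : ℝ, ‖deriv (⇑v) x‖ ^ 2) ^ ((p - 1) / 4))
    (hGN2 : ∀ v : SchwartzMap ℝ ℂ,
      (∫ x : ℝ, ‖v x‖ ^ (p + 1))
        ≤ Chalf * (∫ x : ℝ, ‖v x‖ ^ 2)
            * (∫ ξ : ℝ, 2 * π * |ξ| * ‖𝓕 (⇑v) ξ‖ ^ 2) ^ ((p - 1) / 2))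
    (c δ : ℝ) (hc : 1 ≤ c) (hδ1 : δ ≤ 1) (u : SchwartzMap ℝ ℂ)
    (f : ContDiffBump (0 : ℝ)) (hf : f.rOut = c * δ / (2 * π)) :
    (∫ x : ℝ, ‖u x‖ ^ (p + 1)) ≤ 2 ^ p *
      (C₁ * (∫ x : ℝ, ‖u x‖ ^ 2) ^ ((p + 3) / 4) *
        (2 * ∫ ξ in {ξ : ℝ | 2 * π * |ξ| ≤ c * δ},
                    mSym c (2 * π * ξ) * ‖𝓕 (⇑u) ξ‖ ^ 2) ^ ((p - 1) / 4)
      + Chalf * (∫ x : ℝ, ‖u x‖ ^ 2) *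
        (∫ ξ : ℝ, (1 - f ξ) ^ 2 * (2 * π * |ξ| * ‖𝓕 (⇑u) ξ‖ ^ 2)) ^ ((p - 1) / 2)) := by
  have hc0 : 0 < c := by linarith
  obtain ⟨v, w, huvw, hv, hw⟩ := split_bump u f
  have hfu := u.integral_norm_sq_fourier
  have hfv := v.integral_norm_sq_fourier
  have hfw := w.integral_norm_sq_fourier
  have hIu := schwartz_int_sq (𝓕 u) 0
  simp only [SchwartzMap.fourier_coe, pow_zero, one_mul] at hfu hfv hfw hIu
  have hnv : ∀ ξ, ‖𝓕 (⇑v) ξ‖ ^ 2 = f ξ ^ 2 * ‖𝓕 (⇑u) ξ‖ ^ 2 := by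
    intro ξ
    rw [hv, norm_mul, mul_pow, Complex.norm_real, Real.norm_eq_abs, sq_abs]
  have hnw : ∀ ξ, ‖𝓕 (⇑w) ξ‖ ^ 2 = (1 - f ξ) ^ 2 * ‖𝓕 (⇑u) ξ‖ ^ 2 := by
    intro ξ
    have : (1 - (f ξ : ℂ)) = ((1 - f ξ : ℝ) : ℂ) := by push_cast; rfl
    rw [hw, this, norm_mul, mul_pow, Complex.norm_real, Real.norm_eq_abs, sq_abs]
  have hvu : (∫ x : ℝ, ‖v x‖ ^ 2) ≤ ∫ x : ℝ, ‖u x‖ ^ 2 := by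
    rw [← hfv, ← hfu]
    refine integral_mono_of_nonneg (Filter.Eventually.of_forall fun ξ => by positivity) hIu
      (Filter.Eventually.of_forall fun ξ => ?_)
    simp only [hnv]
    have h0 := f.nonneg' ξ
    have h1 : f ξ ≤ 1 := f.le_one
    exact mul_le_of_le_one_left (by positivity) (by nlinarith)
  have hwu : (∫ x : ℝ, ‖w x‖ ^ 2) ≤ ∫ x : ℝ, ‖u x‖ ^ 2 := by
    rw [← hfw, ← hfu]
    refine integral_mono_of_nonneg (Filter.Eventually.of_forall fun ξ => by positivity) hIu
      (Filter.Eventually.of_forall fun ξ => ?_)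
    simp only [hnw]
    have h0 := f.nonneg' ξ
    have h1 : f ξ ≤ 1 := f.le_one
    exact mul_le_of_le_one_left (by positivity) (by nlinarith)
  have hmeas : MeasurableSet {ξ : ℝ | 2 * π * |ξ| ≤ c * δ} :=
    measurableSet_le (by fun_prop) (by fun_prop)
  have hdv : (∫ x : ℝ, ‖deriv (⇑v) x‖ ^ 2) ≤ 2 * ∫ ξ in {ξ : ℝ | 2 * π * |ξ| ≤ c * δ},
                    mSym c (2 * π * ξ) * ‖𝓕 (⇑u) ξ‖ ^ 2 := by
    rw [deriv_plancherel, ← integral_const_mul, ← integral_indicator hmeas]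
    refine integral_mono_of_nonneg (Filter.Eventually.of_forall fun ξ => by positivity)
      (((schwartz_int_mSym (𝓕 u) c hc0).const_mul 2).indicator hmeas)
      (Filter.Eventually.of_forall fun ξ => ?_)
    simp only [hnv]
    by_cases hξ : ξ ∈ {ξ : ℝ | 2 * π * |ξ| ≤ c * δ}
    · rw [Set.indicator_of_mem hξ]
      have hξ' : 2 * π * |ξ| ≤ c * δ := hξ
      have hl := mSym_low c (2 * π * ξ) (by
        rw [abs_mul, abs_of_pos (by positivity : 0 < 2 * π)]
        nlinarith)
      have h0 := f.nonneg' ξ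
      have h1 : f ξ ≤ 1 := f.le_one
      calc (2 * π * ξ) ^ 2 * (f ξ ^ 2 * ‖𝓕 (⇑u) ξ‖ ^ 2)
          ≤ (2 * π * ξ) ^ 2 * (1 * ‖𝓕 (⇑u) ξ‖ ^ 2) := by gcongr; nlinarith
        _ = (2 * π * ξ) ^ 2 * ‖𝓕 (⇑u) ξ‖ ^ 2 := by ring
        _ ≤ (2 * mSym c (2 * π * ξ)) * ‖𝓕 (⇑u) ξ‖ ^ 2 := by gcongr
        _ = _ := by ring
    · rw [Set.indicator_of_notMem hξ]
      have hξ' : c * δ < 2 * π * |ξ| := not_le.1 hξ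
      have : f ξ = 0 := by
        apply f.zero_of_le_dist
        rw [hf, Real.dist_eq, sub_zero, div_le_iff₀ (by positivity)]
        linarith
      simp [this]
  have hH : (∫ ξ : ℝ, 2 * π * |ξ| * ‖𝓕 (⇑w) ξ‖ ^ 2)
      = ∫ ξ : ℝ, (1 - f ξ) ^ 2 * (2 * π * |ξ| * ‖𝓕 (⇑u) ξ‖ ^ 2) := by
    congr 1
    ext ξ
    rw [hnw]; ring
  have hq : 0 ≤ (p - 1) / 4 := by linarith
  have hq' : 0 ≤ (p - 1) / 2 := by linarith
  have hI0 : ∀ z : SchwartzMap ℝ ℂ, 0 ≤ ∫ x : ℝ, ‖z x‖ ^ 2 :=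
    fun z => integral_nonneg fun x => by positivity
  have hq3 : 0 ≤ (p + 3) / 4 := by linarith
  have h1 := hGN1 v
  have h2 := hGN2 w
  rw [hH] at h2
  have hsum : (∫ x : ℝ, ‖u x‖ ^ (p + 1))
      ≤ 2 ^ p * ((∫ x : ℝ, ‖v x‖ ^ (p + 1)) + ∫ x : ℝ, ‖w x‖ ^ (p + 1)) := by
    have iv := schwartz_int_rpow v (p + 1) (by linarith)
    have iw := schwartz_int_rpow w (p + 1) (by linarith)
    rw [← integral_add iv iw, ← integral_const_mul]
    refine integral_mono_of_nonneg (Filter.Eventually.of_forall fun ξ => by positivity)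
      ((iv.add iw).const_mul _) (Filter.Eventually.of_forall fun x => ?_)
    refine le_trans ?_ (rpow_add_aux ‖v x‖ ‖w x‖ p (by positivity) (by positivity) (by linarith))
    simp only [huvw x]
    gcongr
    exact norm_add_le _ _
  refine hsum.trans ?_
  gcongr
  · refine h1.trans ?_
    have := hI0 v
    gcongr
  · refine h2.trans ?_
    have : 0 ≤ ∫ ξ : ℝ, (1 - f ξ) ^ 2 * (2 * π * |ξ| * ‖𝓕 (⇑u) ξ‖ ^ 2) :=
      integral_nonneg fun ξ => by positivity
    gcongr

lemma bump_tendsto (u : SchwartzMap ℝ ℂ) (c δ : ℝ) (f : ℕ → ContDiffBump (0 : ℝ))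
    (hf : ∀ n, (f n).rOut = c * δ / (2 * π))
    (hf' : Filter.Tendsto (fun n => (f n).rIn) Filter.atTop (nhds (c * δ / (2 * π)))) :
    Filter.Tendsto (fun n => ∫ ξ : ℝ, (1 - f n ξ) ^ 2 * (2 * π * |ξ| * ‖𝓕 (⇑u) ξ‖ ^ 2))
      Filter.atTop (nhds (∫ ξ in {ξ : ℝ | c * δ < 2 * π * |ξ|}, 2 * π * |ξ| * ‖𝓕 (⇑u) ξ‖ ^ 2)) := by
  have hmeas : MeasurableSet {ξ : ℝ | c * δ < 2 * π * |ξ|} :=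
    measurableSet_lt (by fun_prop) (by fun_prop)
  have hcu : Continuous (𝓕 (⇑u)) := (𝓕 u : SchwartzMap ℝ ℂ).continuous
  rw [← integral_indicator hmeas]
  refine tendsto_integral_of_dominated_convergence
    (fun ξ => 2 * π * |ξ| * ‖𝓕 (⇑u) ξ‖ ^ 2) (fun n => ?_) ?_ (fun n => ?_) ?_
  · have := (f n).continuous
    exact Continuous.aestronglyMeasurable (by fun_prop)
  · refine ((schwartz_int_sq (𝓕 u) 1).const_mul (2 * π)).congr
      (Filter.Eventually.of_forall fun ξ => ?_)
    simp only [SchwartzMap.fourier_coe]; ring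
  · refine Filter.Eventually.of_forall fun ξ => ?_
    rw [Real.norm_of_nonneg (by positivity)]
    have h0 := (f n).nonneg' ξ
    have h1 : f n ξ ≤ 1 := (f n).le_one
    exact mul_le_of_le_one_left (by positivity) (by nlinarith)
  · have hfin : ({c * δ / (2 * π), -(c * δ / (2 * π))} : Set ℝ).Finite := by simp
    have hae := compl_mem_ae_iff.2 (hfin.measure_zero volume)
    filter_upwards [hae] with ξ hξ
    by_cases h : c * δ < 2 * π * |ξ|
    · rw [Set.indicator_of_mem (show ξ ∈ {ξ : ℝ | c * δ < 2 * π * |ξ|} from h)]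
      refine tendsto_const_nhds.congr fun n => ?_
      have : f n ξ = 0 := by
        apply (f n).zero_of_le_dist
        rw [hf, Real.dist_eq, sub_zero, div_le_iff₀ (by positivity)]
        linarith
      simp [this]
    · rw [Set.indicator_of_notMem (show ξ ∉ {ξ : ℝ | c * δ < 2 * π * |ξ|} from h)]
      have hne : |ξ| ≠ c * δ / (2 * π) := by
        intro he
        apply hξ
        rcases abs_choice ξ with h' | h'
        · left; rw [← he, h']
        · right; rw [Set.mem_singleton_iff, ← he, h', neg_neg]
      have hlt : |ξ| < c * δ / (2 * π) := by
        refine lt_of_le_of_ne ?_ hne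
        rw [le_div_iff₀ (by positivity)]
        linarith
      refine tendsto_const_nhds.congr' ?_
      filter_upwards [hf'.eventually (lt_mem_nhds hlt)] with n hn
      have : f n ξ = 1 := by
        apply (f n).one_of_mem_closedBall
        rw [Metric.mem_closedBall, Real.dist_eq, sub_zero]
        exact hn.le
      simp [this]

theorem modified_gagliardo_nirenberg (p : ℝ) (hp : 1 < p)
    (C₁ Chalf : ℝ) (hC₁ : 0 < C₁) (hChalf : 0 < Chalf)
    (hGN1 : ∀ v : SchwartzMap ℝ ℂ,
      (∫ x : ℝ, ‖v x‖ ^ (p + 1))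
        ≤ C₁ * (∫ x : ℝ, ‖v x‖ ^ 2) ^ ((p + 3) / 4)
            * (∫ x : ℝ, ‖deriv (⇑v) x‖ ^ 2) ^ ((p - 1) / 4))
    (hGN2 : ∀ v : SchwartzMap ℝ ℂ,
      (∫ x : ℝ, ‖v x‖ ^ (p + 1))
        ≤ Chalf * (∫ x : ℝ, ‖v x‖ ^ 2)
            * (∫ ξ : ℝ, 2 * π * |ξ| * ‖𝓕 (⇑v) ξ‖ ^ 2) ^ ((p - 1) / 2))
    (CGN : ℝ) (hCGN : CGN = 2 ^ ((3 * p - 1) / 2) * max C₁ Chalf) :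
    ∀ c : ℝ, 1 ≤ c → ∀ δ : ℝ, 0 < δ → δ ≤ 1 → ∀ u : SchwartzMap ℝ ℂ,
      (∫ x : ℝ, ‖u x‖ ^ (p + 1))
        ≤ CGN *
          ((∫ x : ℝ, ‖u x‖ ^ 2) ^ ((p + 3) / 4)
              * (∫ ξ in {ξ : ℝ | 2 * π * |ξ| ≤ c * δ},
                    mSym c (2 * π * ξ) * ‖𝓕 (⇑u) ξ‖ ^ 2) ^ ((p - 1) / 4)
            + (c * δ) ^ (-(p - 1) / 2) * (∫ x : ℝ, ‖u x‖ ^ 2)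
              * (∫ ξ in {ξ : ℝ | c * δ < 2 * π * |ξ|},
                    mSym c (2 * π * ξ) * ‖𝓕 (⇑u) ξ‖ ^ 2) ^ ((p - 1) / 2)) := by
  intro c hc δ hδ hδ1 u
  have hc0 : 0 < c := by linarith
  have hcδ : 0 < c * δ := by positivity
  have hR : 0 < c * δ / (2 * π) := by positivity
  let f : ℕ → ContDiffBump (0 : ℝ) := fun n =>
    ⟨c * δ / (2 * π) * ((n + 1 : ℝ) / (n + 2)), c * δ / (2 * π), by positivity, by
      apply mul_lt_of_lt_one_right hR
      rw [div_lt_one (by positivity)]; linarith⟩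
  have hlim : Filter.Tendsto (fun n : ℕ => ((n + 1 : ℝ) / (n + 2))) Filter.atTop (nhds 1) := by
    have h := (tendsto_one_div_add_atTop_nhds_zero_nat (𝕜 := ℝ)).comp (Filter.tendsto_add_atTop_nat 1)
    have h2 := h.const_sub 1
    rw [sub_zero] at h2
    refine h2.congr fun n => ?_
    simp only [Function.comp]
    push_cast
    field_simp
    ring
  have ht := bump_tendsto u c δ f (fun n => rfl) (by
    have := hlim.const_mul (c * δ / (2 * π))
    rwa [mul_one] at this)
  have hq : 0 ≤ (p - 1) / 4 := by linarith
  have hq' : 0 ≤ (p - 1) / 2 := by linarith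
  have hge := ge_of_tendsto' (((ht.rpow_const (Or.inr hq')).const_mul
      (Chalf * (∫ x : ℝ, ‖u x‖ ^ 2))).const_add (C₁ * (∫ x : ℝ, ‖u x‖ ^ 2) ^ ((p + 3) / 4) *
        (2 * ∫ ξ in {ξ : ℝ | 2 * π * |ξ| ≤ c * δ},
                    mSym c (2 * π * ξ) * ‖𝓕 (⇑u) ξ‖ ^ 2) ^ ((p - 1) / 4)) |>.const_mul (2 ^ p))
    (fun n => bump_ineq p hp C₁ Chalf hC₁ hChalf hGN1 hGN2 c δ hc hδ1 u (f n) rfl)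
  refine hge.trans ?_
  have hmeas : MeasurableSet {ξ : ℝ | c * δ < 2 * π * |ξ|} :=
    measurableSet_lt (by fun_prop) (by fun_prop)
  have hhigh : (∫ ξ in {ξ : ℝ | c * δ < 2 * π * |ξ|}, 2 * π * |ξ| * ‖𝓕 (⇑u) ξ‖ ^ 2)
      ≤ 2 * ((c * δ)⁻¹ * ∫ ξ in {ξ : ℝ | c * δ < 2 * π * |ξ|},
                    mSym c (2 * π * ξ) * ‖𝓕 (⇑u) ξ‖ ^ 2) := by
    rw [← integral_const_mul, ← integral_const_mul]
    refine setIntegral_mono_on ?_ ?_ hmeas fun ξ hξ => ?_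
    · refine (((schwartz_int_sq (𝓕 u) 1).const_mul (2 * π)).congr
        (Filter.Eventually.of_forall fun ξ => ?_)).integrableOn
      simp only [SchwartzMap.fourier_coe]; ring
    · exact (((schwartz_int_mSym (𝓕 u) c hc0).const_mul (c * δ)⁻¹).const_mul 2).integrableOn
    · have hξ' : c * δ < 2 * π * |ξ| := hξ
      have habs : |2 * π * ξ| = 2 * π * |ξ| := by
        rw [abs_mul, abs_of_pos (by positivity : 0 < 2 * π)]
      have h := mSym_high c δ (2 * π * ξ) hc0 hδ hδ1 (by rw [habs]; exact hξ'.le)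
      rw [habs] at h
      calc 2 * π * |ξ| * ‖𝓕 (⇑u) ξ‖ ^ 2
          = (c * δ)⁻¹ * (c * δ * (2 * π * |ξ|)) * ‖𝓕 (⇑u) ξ‖ ^ 2 := by field_simp
        _ ≤ (c * δ)⁻¹ * (2 * mSym c (2 * π * ξ)) * ‖𝓕 (⇑u) ξ‖ ^ 2 := by gcongr
        _ = _ := by ring
  have hL : 0 ≤ ∫ ξ in {ξ : ℝ | 2 * π * |ξ| ≤ c * δ}, mSym c (2 * π * ξ) * ‖𝓕 (⇑u) ξ‖ ^ 2 :=
    integral_nonneg fun ξ => mul_nonneg (mSym_nonneg _ _) (by positivity)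
  have hM : 0 ≤ ∫ ξ in {ξ : ℝ | c * δ < 2 * π * |ξ|}, mSym c (2 * π * ξ) * ‖𝓕 (⇑u) ξ‖ ^ 2 :=
    integral_nonneg fun ξ => mul_nonneg (mSym_nonneg _ _) (by positivity)
  have hH : 0 ≤ ∫ ξ in {ξ : ℝ | c * δ < 2 * π * |ξ|}, 2 * π * |ξ| * ‖𝓕 (⇑u) ξ‖ ^ 2 :=
    integral_nonneg fun ξ => by positivity
  have hU : 0 ≤ ∫ x : ℝ, ‖u x‖ ^ 2 := integral_nonneg fun x => by positivity
  generalize (∫ ξ in {ξ : ℝ | 2 * π * |ξ| ≤ c * δ}, mSym c (2 * π * ξ) * ‖𝓕 (⇑u) ξ‖ ^ 2) = L at *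
  generalize (∫ ξ in {ξ : ℝ | c * δ < 2 * π * |ξ|}, mSym c (2 * π * ξ) * ‖𝓕 (⇑u) ξ‖ ^ 2) = M at *
  generalize (∫ ξ in {ξ : ℝ | c * δ < 2 * π * |ξ|}, 2 * π * |ξ| * ‖𝓕 (⇑u) ξ‖ ^ 2) = H at *
  generalize (∫ x : ℝ, ‖u x‖ ^ 2) = U at *
  have e1 : (2 * L) ^ ((p - 1) / 4) ≤ 2 ^ ((p - 1) / 2) * L ^ ((p - 1) / 4) := by
    rw [Real.mul_rpow (by norm_num) hL]
    gcongr
    · norm_num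
    · norm_num
  have e2 : H ^ ((p - 1) / 2)
      ≤ 2 ^ ((p - 1) / 2) * ((c * δ) ^ (-(p - 1) / 2) * M ^ ((p - 1) / 2)) := by
    refine (Real.rpow_le_rpow hH hhigh hq').trans_eq ?_
    rw [Real.mul_rpow (by norm_num) (by positivity), Real.mul_rpow (by positivity) hM,
      Real.inv_rpow hcδ.le, ← Real.rpow_neg hcδ.le, neg_div]
  have e3 : (2 : ℝ) ^ ((3 * p - 1) / 2) = 2 ^ p * 2 ^ ((p - 1) / 2) := by
    rw [← Real.rpow_add (by norm_num)]; congr 1; ring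
  have hU' : 0 ≤ U ^ ((p + 3) / 4) := by positivity
  rw [hCGN, e3]
  calc _ ≤ 2 ^ p * (max C₁ Chalf * U ^ ((p + 3) / 4) * (2 ^ ((p - 1) / 2) * L ^ ((p - 1) / 4))
        + max C₁ Chalf * U
          * (2 ^ ((p - 1) / 2) * ((c * δ) ^ (-(p - 1) / 2) * M ^ ((p - 1) / 2)))) := by
        gcongr
        · exact le_max_left _ _
        · exact le_max_right _ _
    _ = _ := by ring
end

section
/- Let p ∈ [3,5), M > 0, c ≥ 1, and suppose C₁, C_{1/2} > 0 are constants such that for every Schwartz function v : ℝ → ℂ one has ∫_ℝ|v|^{p+1} ≤ C₁ (∫_ℝ|v|²)^{(p+3)/4} (∫_ℝ|v′|²)^{(p−1)/4} and ∫_ℝ|v|^{p+1} ≤ C_{1/2} (∫_ℝ|v|²) (∫_ℝ 2π|ξ| |v̂(ξ)|² dξ)^{(p−1)/2}. Then there exists a real number B such that every Schwartz function u : ℝ → ℂ with 𝓜(u) = M and K_c(u) ≤ c^{(p+3)/(p−1)} satisfies 𝓔_c(u) ≥ B. -/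
open Real MeasureTheory SchwartzMap FourierTransform

/-- The mass `𝓜(u)`. -/
noncomputable def massOf (u : ℝ → ℂ) : ℝ := ∫ x : ℝ, ‖u x‖ ^ 2

/-- The relativistic kinetic energy `K_c(u)`. -/
noncomputable def kineticC (c : ℝ) (u : ℝ → ℂ) : ℝ :=
  ∫ ξ : ℝ, mSym c (2 * π * ξ) * ‖𝓕 u ξ‖ ^ 2

/-- The relativistic energy `𝓔_c(u)`. -/
noncomputable def energyC (c p : ℝ) (u : ℝ → ℂ) : ℝ :=
  (1 / 2) * kineticC c u - (1 / (p + 1)) * ∫ x : ℝ, ‖u x‖ ^ (p + 1)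

theorem aux_bdd_mul (g : SchwartzMap ℝ ℂ) (k : ℕ) :
    Integrable (fun ξ : ℝ => ‖ξ‖ ^ k * ‖g ξ‖ ^ 2) := by
  have h := g.integrable_pow_mul volume k
  obtain ⟨C, hC⟩ : ∃ C, ∀ x, ‖g x‖ ≤ C :=
    ⟨_, fun x => g.norm_le_seminorm ℝ x⟩
  refine (h.mul_const C).mono' (by have := g.continuous; fun_prop) (.of_forall fun x => ?_)
  rw [Real.norm_of_nonneg (by positivity), pow_two, ← mul_assoc]
  gcongr
  exact hC x

theorem aux_m (c ξ : ℝ) (hc : 1 ≤ c) : 0 ≤ mSym c ξ ∧ mSym c ξ ≤ c * |ξ| ∧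
    c * |ξ| ≤ mSym c ξ + c ^ 2 / 2 := by
  unfold mSym
  have ha := sq_abs ξ
  have hn := abs_nonneg ξ
  refine ⟨?_, ?_, ?_⟩
  · rw [sub_nonneg]
    apply Real.le_sqrt_of_sq_le
    nlinarith [mul_nonneg (sq_nonneg c) (sq_nonneg ξ)]
  · rw [sub_le_iff_le_add]
    apply Real.sqrt_le_iff.2
    refine ⟨by positivity, ?_⟩
    rw [← ha]
    have : 0 ≤ c * |ξ| * c ^ 2 := by positivity
    nlinarith
  · rw [sub_add_cancel]
    apply Real.le_sqrt_of_sq_le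
    rw [← ha]
    nlinarith [sq_nonneg (c^2)]

theorem energy_bounded_below (p M c : ℝ) (hp3 : 3 ≤ p) (hp5 : p < 5) (hM : 0 < M)
    (hc : 1 ≤ c)
    (C₁ Chalf : ℝ) (hC₁ : 0 < C₁) (hChalf : 0 < Chalf)
    (hGN1 : ∀ v : SchwartzMap ℝ ℂ,
      (∫ x : ℝ, ‖v x‖ ^ (p + 1))
        ≤ C₁ * (∫ x : ℝ, ‖v x‖ ^ 2) ^ ((p + 3) / 4)
            * (∫ x : ℝ, ‖deriv (⇑v) x‖ ^ 2) ^ ((p - 1) / 4))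
    (hGN2 : ∀ v : SchwartzMap ℝ ℂ,
      (∫ x : ℝ, ‖v x‖ ^ (p + 1))
        ≤ Chalf * (∫ x : ℝ, ‖v x‖ ^ 2)
            * (∫ ξ : ℝ, 2 * π * |ξ| * ‖𝓕 (⇑v) ξ‖ ^ 2) ^ ((p - 1) / 2)) :
    ∃ B : ℝ, ∀ u : SchwartzMap ℝ ℂ, massOf (⇑u) = M →
      kineticC c (⇑u) ≤ c ^ ((p + 3) / (p - 1)) → B ≤ energyC c p (⇑u) := by
  refine ⟨- ((1 / (p + 1)) * (Chalf * M *
    ((c ^ ((p + 3) / (p - 1)) + c ^ 2 / 2 * M) / c) ^ ((p - 1) / 2))), fun u hu hK => ?_⟩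
  have hg : 𝓕 (⇑u) = ⇑(𝓕 u : SchwartzMap ℝ ℂ) := (SchwartzMap.fourier_coe u).symm
  have hpl : ∫ ξ : ℝ, ‖𝓕 (⇑u) ξ‖ ^ 2 = M := by
    rw [← hu, massOf, hg]
    exact SchwartzMap.integral_norm_sq_fourier u
  have hI0 : Integrable (fun ξ : ℝ => ‖𝓕 (⇑u) ξ‖ ^ 2) := by
    rw [hg]; simpa using aux_bdd_mul (𝓕 u) 0
  have hI1 : Integrable (fun ξ : ℝ => 2 * π * |ξ| * ‖𝓕 (⇑u) ξ‖ ^ 2) := by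
    rw [hg]
    simpa [mul_assoc] using (aux_bdd_mul (𝓕 u) 1).const_mul (2 * π)
  have habs : ∀ ξ : ℝ, |2 * π * ξ| = 2 * π * |ξ| := fun ξ => by
    rw [abs_mul, abs_of_pos Real.two_pi_pos]
  have hIm : Integrable (fun ξ : ℝ => mSym c (2 * π * ξ) * ‖𝓕 (⇑u) ξ‖ ^ 2) := by
    refine (hI1.const_mul c).mono' ?_ (.of_forall fun ξ => ?_)
    · rw [hg]
      have := (𝓕 u : SchwartzMap ℝ ℂ).continuous
      unfold mSym
      exact Continuous.aestronglyMeasurable (by fun_prop)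
    · obtain ⟨h1, h2, -⟩ := aux_m c (2 * π * ξ) hc
      rw [Real.norm_of_nonneg (by positivity), ← mul_assoc]
      rw [habs] at h2
      gcongr
  have hK0 : 0 ≤ kineticC c (⇑u) := integral_nonneg fun ξ =>
    mul_nonneg (aux_m c _ hc).1 (by positivity)
  have hc0 : 0 < c := by linarith
  have hJ : ∫ ξ : ℝ, 2 * π * |ξ| * ‖𝓕 (⇑u) ξ‖ ^ 2 ≤
      (c ^ ((p + 3) / (p - 1)) + c ^ 2 / 2 * M) / c := by
    rw [le_div_iff₀' hc0, ← integral_const_mul]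
    calc _ ≤ ∫ ξ : ℝ, (mSym c (2 * π * ξ) * ‖𝓕 (⇑u) ξ‖ ^ 2 +
            c ^ 2 / 2 * ‖𝓕 (⇑u) ξ‖ ^ 2) := by
          refine integral_mono (hI1.const_mul c) (hIm.add (hI0.const_mul _)) fun ξ => ?_
          have h3 := (aux_m c (2 * π * ξ) hc).2.2
          rw [habs] at h3
          dsimp only
          rw [← mul_assoc, ← add_mul]
          gcongr
      _ = kineticC c (⇑u) + c ^ 2 / 2 * M := by
          rw [integral_add hIm (hI0.const_mul _), integral_const_mul, hpl, kineticC]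
      _ ≤ _ := by gcongr
  have hJ0 : 0 ≤ ∫ ξ : ℝ, 2 * π * |ξ| * ‖𝓕 (⇑u) ξ‖ ^ 2 :=
    integral_nonneg fun ξ => by positivity
  have hN := hGN2 u
  have hu' : ∫ x : ℝ, ‖u x‖ ^ 2 = M := hu
  rw [hu'] at hN
  have hN2 : ∫ x : ℝ, ‖u x‖ ^ (p + 1) ≤ Chalf * M *
      ((c ^ ((p + 3) / (p - 1)) + c ^ 2 / 2 * M) / c) ^ ((p - 1) / 2) := by
    refine hN.trans ?_
    gcongr
    linarith
  have hp : 0 ≤ 1 / (p + 1) := by apply one_div_nonneg.2; linarith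
  have := mul_le_mul_of_nonneg_left hN2 hp
  unfold energyC
  linarith
end

section
/- Let p > 1, μ > 0, and let Q : ℝ → ℝ be a nonnegative Schwartz function satisfying Q″(x) = μ Q(x) − Q(x)^p for all x ∈ ℝ. Then the Pohozaev identities hold: ∫_ℝ (Q′(x))² dx = ((p−1)/(p+3)) μ ∫_ℝ Q(x)² dx and ∫_ℝ Q(x)^{p+1} dx = (2(p+1)/(p+3)) μ ∫_ℝ Q(x)² dx. -/
open Real MeasureTheory SchwartzMap

theorem pohozaev_identities (p μ : ℝ) (hp : 1 < p) (hμ : 0 < μ)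
    (Q : SchwartzMap ℝ ℝ) (hQpos : ∀ x : ℝ, 0 ≤ Q x)
    (hQeq : ∀ x : ℝ, deriv (deriv (⇑Q)) x = μ * Q x - Q x ^ p) :
    (∫ x : ℝ, deriv (⇑Q) x ^ 2) = (p - 1) / (p + 3) * μ * ∫ x : ℝ, Q x ^ 2 ∧
    (∫ x : ℝ, Q x ^ (p + 1)) = 2 * (p + 1) / (p + 3) * μ * ∫ x : ℝ, Q x ^ 2 := by
  obtain ⟨R, hR⟩ : ∃ R : SchwartzMap ℝ ℝ, ∀ x, R x = deriv Q x :=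
    ⟨derivCLM ℝ ℝ Q, fun x => derivCLM_apply ℝ Q x⟩
  have hRf : deriv (⇑Q) = ⇑R := (funext hR).symm
  obtain ⟨S, hS⟩ : ∃ S : SchwartzMap ℝ ℝ, ∀ x, S x = deriv R x :=
    ⟨derivCLM ℝ ℝ R, fun x => derivCLM_apply ℝ R x⟩
  rw [hRf] at hQeq ⊢
  have dQ : ∀ x, HasDerivAt Q (R x) x := fun x => by rw [hR]; exact Q.hasDerivAt x
  have dR : ∀ x, HasDerivAt R (S x) x := fun x => by rw [hS]; exact R.hasDerivAt x
  have hSeq : ∀ x, S x = μ * Q x - Q x ^ p := fun x => by rw [hS, hQeq]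
  have iQ : Integrable (fun x => Q x ^ 2) := (Q.memLp 2).integrable_sq
  have iR : Integrable (fun x => R x ^ 2) := (R.memLp 2).integrable_sq
  have iQS : Integrable (fun x => Q x * S x) := (Q.memLp 2).integrable_mul (S.memLp 2)
  have iQR : Integrable (fun x => Q x * R x) := (Q.memLp 2).integrable_mul (R.memLp 2)
  have hpow : ∀ x, Q x ^ (p + 1) = μ * Q x ^ 2 - Q x * S x := fun x => by
    rw [hSeq, Real.rpow_add_one' (hQpos x) (by linarith)]; ring
  have iP : Integrable (fun x => Q x ^ (p + 1)) := by
    simp_rw [hpow]; exact (iQ.const_mul μ).sub iQS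
  have h0 : ∫ x, (R x ^ 2 + Q x * S x) = 0 :=
    integral_eq_zero_of_hasDerivAt_of_integrable (f := fun x => Q x * R x)
      (fun x => by
        have e : R x ^ 2 + Q x * S x = R x * R x + Q x * S x := by ring
        rw [e]
        exact (dQ x).mul (dR x)) (iR.add iQS) iQR
  rw [integral_add iR iQS] at h0
  have hP : ∫ x, Q x ^ (p + 1) = μ * (∫ x, Q x ^ 2) - ∫ x, Q x * S x := by
    simp_rw [hpow]
    rw [integral_sub (iQ.const_mul μ) iQS, integral_const_mul]
  let E : ℝ → ℝ := fun x => R x ^ 2 - μ * Q x ^ 2 + 2 / (p + 1) * Q x ^ (p + 1)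
  have dE : ∀ x, HasDerivAt E 0 x := fun x => by
    have h1 := ((dR x).pow 2).sub (((dQ x).pow 2).const_mul μ)
    have h2 := ((dQ x).rpow_const (p := p + 1) (Or.inr (by linarith))).const_mul (2 / (p + 1))
    refine HasDerivAt.congr_deriv (f := E) (h1.add h2) ?_
    rw [hSeq, add_sub_cancel_right]
    have : p + 1 ≠ 0 := by linarith
    field_simp
    push_cast
    ring
  have iE : Integrable E := (iR.sub (iQ.const_mul μ)).add (iP.const_mul _)
  have cE : E = fun _ => E 0 := funext fun x =>
    is_const_of_deriv_eq_zero (fun x => (dE x).differentiableAt) (fun x => (dE x).deriv) x 0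
  have E0 : E 0 = 0 := by
    rw [cE, integrable_const_iff] at iE
    rcases iE with h | h
    · exact h
    · have := h.measure_univ_lt_top
      simp at this
  have hE : ∫ x, E x = 0 := by rw [cE, E0]; simp
  have hE' : (∫ x, R x ^ 2) - μ * (∫ x, Q x ^ 2) + 2 / (p + 1) * (∫ x, Q x ^ (p + 1)) = 0 := by
    rw [← hE, ← integral_const_mul, ← integral_const_mul, ← integral_sub iR (iQ.const_mul μ)]
    exact (integral_add (iR.sub (iQ.const_mul μ)) (iP.const_mul _)).symm
  have h1 : p + 1 ≠ 0 := by linarith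
  have h3 : p + 3 ≠ 0 := by linarith
  generalize (∫ x, R x ^ 2) = A at *
  generalize (∫ x, Q x ^ 2) = M at *
  generalize (∫ x, Q x ^ (p + 1)) = P at *
  generalize (∫ x, Q x * S x) = T at *
  field_simp at hE' ⊢
  constructor
  · linear_combination hE' - 2 * hP + 2 * h0
  · linear_combination hE' + (p + 1) * hP - (p + 1) * h0
end

section
/- Let p > 1, μ > 0, and let Q : ℝ → ℝ be a nonnegative Schwartz function satisfying Q″(x) = μ Q(x) − Q(x)^p for all x ∈ ℝ. Then its non-relativistic energy satisfies 𝓔_∞(Q) = (1/2)∫_ℝ (Q′)² − (1/(p+1))∫_ℝ Q^{p+1} = −((5−p)/(2(p+3))) μ ∫_ℝ Q². In particular 𝓔_∞(Q) < 0 whenever 1 < p < 5 and Q is not identically zero. -/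
open Real MeasureTheory SchwartzMap

/-- The non-relativistic energy `𝓔_∞` of a real-valued function. -/
noncomputable def energyInf (p : ℝ) (u : ℝ → ℝ) : ℝ :=
  (1 / 2) * (∫ x : ℝ, |deriv u x| ^ 2) - (1 / (p + 1)) * ∫ x : ℝ, |u x| ^ (p + 1)

theorem soliton_energy (p μ : ℝ) (hp : 1 < p) (hμ : 0 < μ)
    (Q : SchwartzMap ℝ ℝ) (hQpos : ∀ x : ℝ, 0 ≤ Q x)
    (hQeq : ∀ x : ℝ, deriv (deriv (⇑Q)) x = μ * Q x - Q x ^ p) :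
    energyInf p (⇑Q)
        = (1 / 2) * (∫ x : ℝ, deriv (⇑Q) x ^ 2) - (1 / (p + 1)) * (∫ x : ℝ, Q x ^ (p + 1)) ∧
    energyInf p (⇑Q) = -((5 - p) / (2 * (p + 3))) * μ * ∫ x : ℝ, Q x ^ 2 ∧
    (p < 5 → (∃ x : ℝ, Q x ≠ 0) → energyInf p (⇑Q) < 0) := by
  have hD : ∀ x, derivCLM ℝ ℝ Q x = deriv Q x := fun x => derivCLM_apply ℝ Q x
  have hDf : (⇑(derivCLM ℝ ℝ Q)) = deriv Q := funext hD
  have h1 : ∀ x, HasDerivAt Q (deriv Q x) x := fun x => Q.hasDerivAt x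
  have h2 : ∀ x, HasDerivAt (deriv Q) (μ * Q x - Q x ^ p) x := by
    intro x
    have := (derivCLM ℝ ℝ Q).hasDerivAt x
    rw [hDf, hQeq] at this
    exact this
  have hp1 : ∀ x, Q x ^ (p + 1) = Q x ^ p * Q x := fun x =>
    Real.rpow_add_one' (hQpos x) (by linarith)
  have hmul : ∀ f g : SchwartzMap ℝ ℝ, Integrable (fun x => f x * g x) := fun f g =>
    (f.memLp 2 volume).integrable_mul (g.memLp 2 volume)
  have iC : Integrable (fun x => Q x ^ 2) := by
    simpa only [pow_two] using hmul Q Q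
  have iA : Integrable (fun x => deriv Q x ^ 2) := by
    simpa only [pow_two, hD] using hmul (derivCLM ℝ ℝ Q) (derivCLM ℝ ℝ Q)
  have iB : Integrable (fun x => Q x ^ (p + 1)) := by
    have := (iC.const_mul μ).sub (hmul Q (derivCLM ℝ ℝ (derivCLM ℝ ℝ Q)))
    refine this.congr (Filter.Eventually.of_forall fun x => ?_)
    simp only [Pi.sub_apply, derivCLM_apply, hDf, hQeq, hp1]
    ring
  have iQD : Integrable (fun x => Q x * deriv Q x) := by
    simpa only [hD] using hmul Q (derivCLM ℝ ℝ Q)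
  have e1 : (∫ x, deriv Q x ^ 2) + μ * (∫ x, Q x ^ 2) - (∫ x, Q x ^ (p + 1)) = 0 := by
    have hi : Integrable (fun x => deriv Q x ^ 2 + μ * Q x ^ 2 - Q x ^ (p + 1)) :=
      (iA.add (iC.const_mul μ)).sub iB
    have := integral_eq_zero_of_hasDerivAt_of_integrable (f := fun x => Q x * deriv Q x)
      (f' := fun x => deriv Q x ^ 2 + μ * Q x ^ 2 - Q x ^ (p + 1)) (fun x => by
        refine ((h1 x).mul (h2 x)).congr_deriv ?_
        rw [hp1]; ring) hi iQD
    rw [integral_sub (by exact iA.add (iC.const_mul μ)) iB,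
      integral_add iA (iC.const_mul μ), integral_const_mul] at this
    exact this
  have hH : ∀ x, deriv Q x ^ 2 = μ * Q x ^ 2 - 2 / (p + 1) * Q x ^ (p + 1) := by
    have hd : ∀ x, HasDerivAt
        (fun x => deriv Q x ^ 2 - (μ * Q x ^ 2 - 2 / (p + 1) * Q x ^ (p + 1))) 0 x := by
      intro x
      have := ((h2 x).pow 2).sub ((((h1 x).pow 2).const_mul μ).sub
        (((h1 x).rpow_const (p := p + 1) (Or.inr (by linarith))).const_mul (2 / (p + 1))))
      refine this.congr_deriv ?_
      have : p + 1 ≠ 0 := by linarith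
      simp only [add_sub_cancel_right]
      field_simp
      push_cast
      ring
    have hi : Integrable
        (fun x => deriv Q x ^ 2 - (μ * Q x ^ 2 - 2 / (p + 1) * Q x ^ (p + 1))) :=
      iA.sub ((iC.const_mul μ).sub (iB.const_mul _))
    intro x
    have hc := is_const_of_deriv_eq_zero (fun y => (hd y).differentiableAt)
      (fun y => (hd y).deriv)
    have ht := tendsto_zero_of_hasDerivAt_of_integrableOn_Ioi (a := 0)
      (fun y _ => hd y) (integrable_zero _ _ _).integrableOn hi.integrableOn
    have ht2 := ht.congr (fun y => hc y x)
    have := tendsto_nhds_unique ht2 tendsto_const_nhds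
    linarith
  have e2 : (∫ x, deriv Q x ^ 2) = μ * (∫ x, Q x ^ 2) - 2 / (p + 1) * ∫ x, Q x ^ (p + 1) := by
    simp_rw [hH]
    rw [integral_sub (iC.const_mul μ) (iB.const_mul _), integral_const_mul, integral_const_mul]
  have E1 : energyInf p (⇑Q)
      = (1 / 2) * (∫ x : ℝ, deriv (⇑Q) x ^ 2) - (1 / (p + 1)) * (∫ x : ℝ, Q x ^ (p + 1)) := by
    simp only [energyInf, sq_abs, abs_of_nonneg (hQpos _)]
  have E2 : energyInf p (⇑Q) = -((5 - p) / (2 * (p + 3))) * μ * ∫ x : ℝ, Q x ^ 2 := by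
    rw [E1]
    generalize (∫ x, deriv Q x ^ 2) = A at *
    generalize (∫ x, Q x ^ (p + 1)) = B at *
    generalize (∫ x, Q x ^ 2) = C at *
    have h3 : p + 1 ≠ 0 := by linarith
    have h4 : p + 3 ≠ 0 := by linarith
    obtain rfl : B = A + μ * C := by linarith
    have hA : A = μ * C * (p - 1) / (p + 3) := by
      field_simp at e2 ⊢
      linarith
    rw [hA]
    field_simp
    ring
  refine ⟨E1, E2, fun h5 ⟨x, hx⟩ => ?_⟩
  have hC : 0 < ∫ x, Q x ^ 2 :=
    integral_pos_of_integrable_nonneg_nonzero (x := x) (Q.continuous.pow 2) iC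
      (fun y => sq_nonneg _) (pow_ne_zero 2 hx)
  rw [E2]
  have : 0 < (5 - p) / (2 * (p + 3)) := div_pos (by linarith) (by linarith)
  have := mul_pos (mul_pos this hμ) hC
  linarith
end

section
/- Let c > 0 and let u : ℝ → ℂ be a Schwartz function. Then 0 ≤ ∫_ℝ |u′(x)|² dx − K_c(u) ≤ (1/c²) ∫_ℝ |u″(x)|² dx. -/
open Real MeasureTheory SchwartzMap FourierTransform

lemma mSym_bounds (c y : ℝ) (hc : 0 < c) :
    0 ≤ mSym c y ∧ mSym c y ≤ y ^ 2 ∧ y ^ 2 - mSym c y ≤ 1 / c ^ 2 * (y ^ 2) ^ 2 := by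
  have hs := Real.sq_sqrt (show 0 ≤ c ^ 2 * y ^ 2 + c ^ 4 / 4 by positivity)
  have hm : mSym c y * (mSym c y + c ^ 2) = c ^ 2 * y ^ 2 := by
    unfold mSym; linear_combination hs
  have hc2 : 0 < c ^ 2 := by positivity
  have h0 : 0 ≤ mSym c y := by
    unfold mSym
    rw [sub_nonneg]
    apply Real.le_sqrt_of_sq_le
    nlinarith [mul_nonneg hc2.le (sq_nonneg y)]
  generalize mSym c y = m at *
  have h1 : m ≤ y ^ 2 := by
    refine le_of_mul_le_mul_left ?_ hc2
    nlinarith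
  refine ⟨h0, h1, ?_⟩
  have h2 : m ^ 2 ≤ (y ^ 2) ^ 2 := pow_le_pow_left₀ h0 h1 2
  rw [one_div, ← div_eq_inv_mul, le_div_iff₀ hc2]
  nlinarith

lemma plancherel_deriv (v : SchwartzMap ℝ ℂ) (ξ : ℝ) :
    ‖𝓕 (⇑(derivCLM ℝ ℂ v)) ξ‖ ^ 2 = (2 * π * ξ) ^ 2 * ‖𝓕 (⇑v) ξ‖ ^ 2 := by
  have e : (⇑(derivCLM ℝ ℂ v)) = deriv ⇑v := by ext x; simp
  have h := Real.fourier_deriv v.integrable v.differentiable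
    (e ▸ (derivCLM ℝ ℂ v).integrable)
  rw [e, h]
  simp only [norm_smul, mul_pow, norm_mul]
  simp [mul_pow]

lemma sq_int (v : SchwartzMap ℝ ℂ) : Integrable (fun ξ => ‖𝓕 (⇑v) ξ‖ ^ 2) := by
  have := (𝓕 v).memLp 2 volume
  rw [SchwartzMap.fourier_coe] at this
  exact this.integrable_norm_pow (by norm_num)

theorem kinetic_energy_comparison (c : ℝ) (hc : 0 < c) (u : SchwartzMap ℝ ℂ) :
    0 ≤ (∫ x : ℝ, ‖deriv (⇑u) x‖ ^ 2) - kineticC c (⇑u) ∧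
    (∫ x : ℝ, ‖deriv (⇑u) x‖ ^ 2) - kineticC c (⇑u)
      ≤ (1 / c ^ 2) * ∫ x : ℝ, ‖deriv (deriv (⇑u)) x‖ ^ 2 := by
  have e (v : SchwartzMap ℝ ℂ) : deriv ⇑v = (⇑(derivCLM ℝ ℂ v)) := by ext x; simp
  have P (v : SchwartzMap ℝ ℂ) : ∫ x, ‖v x‖ ^ 2 = ∫ x, ‖𝓕 (⇑v) x‖ ^ 2 := by
    rw [← SchwartzMap.integral_norm_sq_fourier v, SchwartzMap.fourier_coe]
  have i1 := sq_int (derivCLM ℝ ℂ u)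
  have i2 := sq_int (derivCLM ℝ ℂ (derivCLM ℝ ℂ u))
  rw [e u, e, P, P, kineticC]
  simp only [plancherel_deriv] at i1 i2 ⊢
  have i0 : Integrable (fun ξ : ℝ => mSym c (2 * π * ξ) * ‖𝓕 (⇑u) ξ‖ ^ 2) := by
    refine i1.mono' ?_ (Filter.Eventually.of_forall fun ξ => ?_)
    · refine AEStronglyMeasurable.mul ?_ (sq_int u).aestronglyMeasurable
      apply Continuous.aestronglyMeasurable
      unfold mSym
      fun_prop
    · obtain ⟨h0, h1, -⟩ := mSym_bounds c (2 * π * ξ) hc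
      rw [Real.norm_of_nonneg (by positivity)]
      gcongr
  rw [← integral_sub i1 i0, ← integral_const_mul]
  constructor
  · refine integral_nonneg fun ξ => ?_
    obtain ⟨h0, h1, -⟩ := mSym_bounds c (2 * π * ξ) hc
    simp only [Pi.zero_apply, ← sub_mul]
    exact mul_nonneg (by linarith) (by positivity)
  · refine integral_mono (i1.sub i0) (i2.const_mul _) fun ξ => ?_
    obtain ⟨h0, h1, h2⟩ := mSym_bounds c (2 * π * ξ) hc
    have := mul_le_mul_of_nonneg_right h2 (sq_nonneg ‖𝓕 (⇑u) ξ‖)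
    simp only
    linarith
end

section
/- Let p ∈ (1,5), μ > 0, and let Q : ℝ → ℝ be a nonnegative Schwartz function, not identically zero, satisfying Q″(x) = μ Q(x) − Q(x)^p for all x ∈ ℝ. Set M = ∫_ℝ Q² and C = ∫_ℝ Q^{p+1} / ( (∫_ℝ Q²)^{(p+3)/4} (∫_ℝ (Q′)²)^{(p−1)/4} ). Then: (i) C = (2(p+1)/((p+3)^{(5−p)/4}(p−1)^{(p−1)/4})) · μ^{(5−p)/4} / M^{(p−1)/2}; (ii) μ = (p+3) · ( (p−1)^{(p−1)/4} C / (2(p+1)) )^{4/(5−p)} · M^{2(p−1)/(5−p)}; (iii) ∫_ℝ (Q′)² = ( (p−1)C/(2(p+1)) )^{4/(5−p)} · M^{(p+3)/(5−p)}; (iv) 𝓔_∞(Q) = −((5−p)/2) · ( (p−1)^{(p−1)/4} C / (2(p+1)) )^{4/(5−p)} · M^{(p+3)/(5−p)}. -/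
open Real MeasureTheory SchwartzMap

theorem sol_algebra (p μ M C K N : ℝ) (hp1 : 1 < p) (hp5 : p < 5) (hμ : 0 < μ) (hM : 0 < M)
    (hN : N = 2 * (p + 1) * (μ / (p + 3)) * M) (hK : K = (p - 1) * (μ / (p + 3)) * M)
    (hC : C = N / (M ^ ((p + 3) / 4) * K ^ ((p - 1) / 4))) :
    C = 2 * (p + 1) / ((p + 3) ^ ((5 - p) / 4) * (p - 1) ^ ((p - 1) / 4))
          * μ ^ ((5 - p) / 4) / M ^ ((p - 1) / 2) ∧
    (μ / (p + 3)) = ((p - 1) ^ ((p - 1) / 4) * C / (2 * (p + 1))) ^ (4 / (5 - p))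
          * M ^ (2 * (p - 1) / (5 - p)) ∧
    ((p - 1) * C / (2 * (p + 1))) ^ (4 / (5 - p)) =
      (p - 1) * ((p - 1) ^ ((p - 1) / 4) * C / (2 * (p + 1))) ^ (4 / (5 - p)) ∧
    M ^ ((p + 3) / (5 - p)) = M ^ (2 * (p - 1) / (5 - p)) * M := by
  have h1 : 0 < p - 1 := by linarith
  have h3 : 0 < p + 3 := by linarith
  have h5 : 0 < 5 - p := by linarith
  have h6 : 0 < p + 1 := by linarith
  set ν := μ / (p + 3) with hν
  have hνp : 0 < ν := by positivity
  clear_value ν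
  have hNp : 0 < N := by rw [hN]; positivity
  have hKp : 0 < K := by rw [hK]; positivity
  have hCp : 0 < C := by rw [hC]; positivity
  have hlogC : log C = log (2 * (p + 1)) + (5 - p) / 4 * log ν - (p - 1) / 4 * log (p - 1)
      - (p - 1) / 2 * log M := by
    rw [hC, log_div (by positivity) (by positivity), log_mul (by positivity) (by positivity),
      log_rpow hM, log_rpow hKp, hK, hN, log_mul (by positivity) (by positivity),
      log_mul (by positivity) (by positivity), log_mul (x := (p - 1) * ν) (by positivity) (by positivity),
      log_mul (x := (p - 1)) (by positivity) (by positivity)]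
    ring
  have hlogν : log ν = log μ - log (p + 3) := by
    rw [hν, log_div (by positivity) (by positivity)]
  refine ⟨?_, ?_, ?_, ?_⟩
  · apply log_injOn_pos (Set.mem_Ioi.2 hCp) (Set.mem_Ioi.2 (by positivity))
    rw [log_div (by positivity) (by positivity),
      log_mul (by positivity) (by positivity), log_div (by positivity) (by positivity),
      log_mul (x := (p + 3) ^ ((5 - p) / 4)) (by positivity) (by positivity),
      log_rpow h3, log_rpow h1, log_rpow hμ, log_rpow hM, hlogC, hlogν]
    ring
  · apply log_injOn_pos (Set.mem_Ioi.2 hνp) (Set.mem_Ioi.2 (by positivity))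
    rw [log_mul (by positivity) (by positivity), log_rpow (by positivity), log_rpow hM,
      log_div (by positivity) (by positivity), log_mul (by positivity) (by positivity),
      log_rpow h1, hlogC]
    field_simp
    ring
  · apply log_injOn_pos (Set.mem_Ioi.2 (by positivity)) (Set.mem_Ioi.2 (by positivity))
    rw [log_mul (by positivity) (by positivity), log_rpow (by positivity),
      log_rpow (by positivity),
      log_div (by positivity) (by positivity), log_div (by positivity) (by positivity),
      log_mul (x := (p - 1)) (y := C) (by positivity) (by positivity),
      log_mul (x := (p - 1) ^ ((p - 1) / 4)) (by positivity) (by positivity),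
      log_rpow h1]
    field_simp
    ring
  · rw [← rpow_add_one hM.ne']
    congr 1
    field_simp
    ring

theorem sol_integrals (p μ : ℝ) (hp1 : 1 < p)
    (Q : SchwartzMap ℝ ℝ) (hQpos : ∀ x : ℝ, 0 ≤ Q x) (hQne : ∃ x : ℝ, Q x ≠ 0)
    (hQeq : ∀ x : ℝ, deriv (deriv (⇑Q)) x = μ * Q x - Q x ^ p) :
    0 < (∫ x : ℝ, Q x ^ 2) ∧
    (∫ x : ℝ, Q x ^ (p + 1)) = (∫ x : ℝ, deriv (⇑Q) x ^ 2) + μ * ∫ x : ℝ, Q x ^ 2 ∧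
    (∫ x : ℝ, deriv (⇑Q) x ^ 2) = μ * (∫ x : ℝ, Q x ^ 2)
      - 2 / (p + 1) * ∫ x : ℝ, Q x ^ (p + 1) := by
  have key : ∀ f g : SchwartzMap ℝ ℝ, Integrable (fun x => f x * g x) := fun f g =>
    (f.memLp 2 volume).integrable_mul (g.memLp 2 volume)
  set D := SchwartzMap.derivCLM ℝ ℝ Q with hD
  set D2 := SchwartzMap.derivCLM ℝ ℝ D with hD2
  have eD : ∀ x, deriv (⇑Q) x = D x := fun x => (SchwartzMap.derivCLM_apply ℝ Q x).symm
  have eDf : deriv (⇑Q) = ⇑D := funext eD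
  have eD2 : ∀ x, D2 x = μ * Q x - Q x ^ p := fun x => by
    rw [← hQeq, eDf]; exact SchwartzMap.derivCLM_apply ℝ D x
  have dQ : ∀ x, HasDerivAt (⇑Q) (D x) x := fun x => by
    rw [← eD]; exact Q.differentiableAt.hasDerivAt
  have dD : ∀ x, HasDerivAt (⇑D) (D2 x) x := fun x => by
    have := D.differentiableAt (x := x) |>.hasDerivAt
    rwa [← SchwartzMap.derivCLM_apply ℝ D x] at this
  have hpow : ∀ x, Q x ^ (p + 1) = Q x ^ p * Q x := fun x =>
    rpow_add_one' (hQpos x) (by linarith)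
  have i2 : Integrable (fun x => Q x ^ 2) := by simpa [sq] using key Q Q
  have iD : Integrable (fun x => D x ^ 2) := by simpa [sq] using key D D
  have iN : Integrable (fun x => Q x ^ (p + 1)) := by
    refine ((i2.const_mul μ).sub (key Q D2)).congr (ae_of_all _ fun x => ?_)
    simp only [Pi.sub_apply, hpow, eD2]; ring
  simp only [eDf]
  refine ⟨?_, ?_, ?_⟩
  · obtain ⟨x, hx⟩ := hQne
    exact integral_pos_of_integrable_nonneg_nonzero (x := x) (Q.continuous.pow 2) i2
      (fun x => sq_nonneg (Q x)) (pow_ne_zero 2 hx)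
  · have h := integral_eq_zero_of_hasDerivAt_of_integrable (f := fun x => Q x * D x)
      (f' := fun x => D x * D x + Q x * D2 x) (fun x => (dQ x).mul (dD x))
      ((key D D).add (key Q D2)) (key Q D)
    have e : (fun x => D x * D x + Q x * D2 x)
        = fun x => (D x ^ 2 + μ * Q x ^ 2) - Q x ^ (p + 1) := by
      funext x; rw [hpow, eD2]; ring
    have iA : Integrable (fun x => D x ^ 2 + μ * Q x ^ 2) := iD.add (i2.const_mul μ)
    rw [e, integral_sub iA iN, integral_add iD (i2.const_mul μ),
      integral_const_mul] at h
    linarith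
  · let H : ℝ → ℝ := fun x => D x ^ 2 - (μ * Q x ^ 2 - 2 / (p + 1) * Q x ^ (p + 1))
    have iH : Integrable H := iD.sub ((i2.const_mul μ).sub (iN.const_mul _))
    have dH : ∀ x, HasDerivAt H 0 x := fun x => by
      have h := ((dD x).pow 2).sub ((((dQ x).pow 2).const_mul μ).sub
        (((dQ x).rpow_const (p := p + 1) (Or.inr (by linarith))).const_mul (2 / (p + 1))))
      refine h.congr_deriv ?_
      have : p + 1 ≠ 0 := by linarith
      rw [eD2, add_sub_cancel_right]
      field_simp
      push_cast
      ring
    have hc : ∀ x, H x = H 0 := fun x =>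
      is_const_of_deriv_eq_zero (fun x => (dH x).differentiableAt) (fun x => (dH x).deriv) x 0
    have hcf : H = fun _ => H 0 := funext hc
    have h0 : ∫ x, H x = 0 := by
      rw [hcf] at iH ⊢
      rcases integrable_const_iff.1 iH with h | h
      · simp [h]
      · exact absurd h.measure_univ_lt_top (by simp)
    have : ∫ x, H x = (∫ x, D x ^ 2) - (μ * (∫ x, Q x ^ 2) - 2 / (p + 1) * ∫ x, Q x ^ (p + 1)) := by
      simp only [H]
      have iA : Integrable (fun x => μ * Q x ^ 2 - 2 / (p + 1) * Q x ^ (p + 1)) :=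
        (i2.const_mul μ).sub (iN.const_mul _)
      rw [integral_sub iD iA,
        integral_sub (i2.const_mul μ) (iN.const_mul _), integral_const_mul, integral_const_mul]
    linarith

theorem soliton_constants (p μ : ℝ) (hp1 : 1 < p) (hp5 : p < 5) (hμ : 0 < μ)
    (Q : SchwartzMap ℝ ℝ) (hQpos : ∀ x : ℝ, 0 ≤ Q x) (hQne : ∃ x : ℝ, Q x ≠ 0)
    (hQeq : ∀ x : ℝ, deriv (deriv (⇑Q)) x = μ * Q x - Q x ^ p)
    (M C : ℝ) (hM : M = ∫ x : ℝ, Q x ^ 2)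
    (hC : C = (∫ x : ℝ, Q x ^ (p + 1)) /
        ((∫ x : ℝ, Q x ^ 2) ^ ((p + 3) / 4) * (∫ x : ℝ, deriv (⇑Q) x ^ 2) ^ ((p - 1) / 4))) :
    C = 2 * (p + 1) / ((p + 3) ^ ((5 - p) / 4) * (p - 1) ^ ((p - 1) / 4))
          * μ ^ ((5 - p) / 4) / M ^ ((p - 1) / 2) ∧
    μ = (p + 3) * ((p - 1) ^ ((p - 1) / 4) * C / (2 * (p + 1))) ^ (4 / (5 - p))
          * M ^ (2 * (p - 1) / (5 - p)) ∧
    (∫ x : ℝ, deriv (⇑Q) x ^ 2)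
        = ((p - 1) * C / (2 * (p + 1))) ^ (4 / (5 - p)) * M ^ ((p + 3) / (5 - p)) ∧
    energyInf p (⇑Q)
        = -((5 - p) / 2) * ((p - 1) ^ ((p - 1) / 4) * C / (2 * (p + 1))) ^ (4 / (5 - p))
            * M ^ ((p + 3) / (5 - p)) := by
  obtain ⟨hMp, hn, hk⟩ := sol_integrals p μ hp1 Q hQpos hQne hQeq
  have hE : energyInf p (⇑Q) = (1 / 2) * (∫ x : ℝ, deriv (⇑Q) x ^ 2)
      - (1 / (p + 1)) * ∫ x : ℝ, Q x ^ (p + 1) := by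
    unfold energyInf
    simp only [sq_abs, fun x => abs_of_nonneg (hQpos x)]
  rw [hE]
  rw [← hM] at hC hMp hn hk
  generalize (∫ x : ℝ, Q x ^ (p + 1)) = N at *
  generalize (∫ x : ℝ, deriv (⇑Q) x ^ 2) = K at *
  have h3 : p + 3 ≠ 0 := by linarith
  have h6 : p + 1 ≠ 0 := by linarith
  have hN : N = 2 * (p + 1) * (μ / (p + 3)) * M := by
    have : N = μ * M - 2 / (p + 1) * N + μ * M := by linarith
    field_simp at this ⊢
    linarith
  have hK : K = (p - 1) * (μ / (p + 3)) * M := by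
    have : K = N - μ * M := by linarith
    rw [this, hN]
    field_simp
    ring
  obtain ⟨a, b, c, d⟩ := sol_algebra p μ M C K N hp1 hp5 hμ hMp hN hK hC
  refine ⟨a, ?_, ?_, ?_⟩
  · rw [mul_assoc, ← b]; field_simp
  · rw [c, d, hK, b]; ring
  · have : (1 / 2) * K - (1 / (p + 1)) * N = -((5 - p) / 2) * (μ / (p + 3)) * M := by
      rw [hK, hN]; field_simp; ring
    rw [this, d, b]; ring
end

section
/- Let p ∈ (1,5) and μ > 0, and let Q : ℝ → ℝ be given by Q(x) = ((p+1)μ/2)^{1/(p−1)} · sech( (p−1)√μ x / 2 )^{2/(p−1)}. Then Q optimizes the Gagliardo–Nirenberg inequality: for every Schwartz function u : ℝ → ℂ, ∫_ℝ |u|^{p+1} ≤ ( ∫_ℝ Q^{p+1} / ( (∫_ℝ Q²)^{(p+3)/4} (∫_ℝ (Q′)²)^{(p−1)/4} ) ) · (∫_ℝ |u|²)^{(p+3)/4} (∫_ℝ |u′|²)^{(p−1)/4}. -/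
open Real MeasureTheory SchwartzMap

/-- The hyperbolic secant. -/
noncomputable def sech (t : ℝ) : ℝ := 2 / (Real.exp t + Real.exp (-t))

section gn
open Filter Topology Set

noncomputable def gnPhi (p m t : ℝ) : ℝ :=
  ∫ τ in (0:ℝ)..t, (1/2) * √(m ^ (p-1) - τ ^ ((p-1)/2))

lemma gnPhi_cont (p m : ℝ) (hp : 1 < p) :
    Continuous (fun τ : ℝ => (1/2) * √(m ^ (p-1) - τ ^ ((p-1)/2))) := by
  have : Continuous (fun τ : ℝ => τ ^ ((p-1)/2)) :=
    Real.continuous_rpow_const (by linarith)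
  fun_prop

lemma gnPhi_hasDerivAt (p m : ℝ) (hp : 1 < p) (t : ℝ) :
    HasDerivAt (gnPhi p m) ((1/2) * √(m ^ (p-1) - t ^ ((p-1)/2))) t :=
  (gnPhi_cont p m hp).integral_hasStrictDerivAt 0 t |>.hasDerivAt

lemma gnPhi_zero (p m : ℝ) : gnPhi p m 0 = 0 := by simp [gnPhi]

lemma gnPhi_scale (p m : ℝ) (hm : 0 < m) :
    gnPhi p m (m^2) = m ^ ((p+3)/2) * gnPhi p 1 1 := by
  unfold gnPhi
  have h := intervalIntegral.mul_integral_comp_mul_left (a := 0) (b := 1)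
    (f := fun τ : ℝ => (1/2) * √(m ^ (p-1) - τ ^ ((p-1)/2))) (m^2)
  rw [mul_zero, mul_one] at h
  rw [← h, ← intervalIntegral.integral_const_mul, ← intervalIntegral.integral_const_mul]
  apply intervalIntegral.integral_congr
  intro x hx
  rw [uIcc_of_le zero_le_one] at hx
  have h0 : m ^ (p-1) = (m ^ ((p-1)/2))^2 := by
    rw [← Real.rpow_natCast, ← Real.rpow_mul hm.le]; congr 1; push_cast; ring
  have h1 : (m^2 * x) ^ ((p-1)/2) = m ^ (p-1) * x ^ ((p-1)/2) := by
    rw [Real.mul_rpow (by positivity) hx.1, ← Real.rpow_natCast m 2, ← Real.rpow_mul hm.le]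
    congr 2; push_cast; ring
  have h2 : m ^ ((p+3)/2) = m^2 * m ^ ((p-1)/2) := by
    rw [← Real.rpow_natCast m 2, ← Real.rpow_add hm]; congr 1; push_cast; ring
  simp only [h1, h2, Real.one_rpow]
  rw [show m ^ (p-1) - m ^ (p-1) * x ^ ((p-1)/2) = (m ^ ((p-1)/2))^2 * (1 - x ^ ((p-1)/2)) by
    rw [h0]; ring, Real.sqrt_mul (by positivity), Real.sqrt_sq (by positivity)]
  ring

lemma gnPhi_pos (p : ℝ) (hp : 1 < p) : 0 < gnPhi p 1 1 := by
  unfold gnPhi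
  apply intervalIntegral.intervalIntegral_pos_of_pos_on
    ((gnPhi_cont p 1 hp).intervalIntegrable _ _) _ zero_lt_one
  intro x hx
  have : x ^ ((p-1)/2) < 1 := Real.rpow_lt_one hx.1.le hx.2 (by linarith)
  have h : 0 < √((1:ℝ) ^ (p-1) - x ^ ((p-1)/2)) := by
    apply Real.sqrt_pos.2; rw [Real.one_rpow]; linarith
  positivity

lemma gn_cs (f g : ℝ → ℝ) (hf0 : ∀ x, 0 ≤ f x) (hg0 : ∀ x, 0 ≤ g x) (hf : MemLp f 2) (hg : MemLp g 2) :
    (∫ x, f x * g x)^2 ≤ (∫ x, f x ^ 2) * ∫ x, g x ^ 2 := by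
  have h := integral_mul_le_Lp_mul_Lq_of_nonneg (μ := volume) Real.HolderConjugate.two_two
    (f := f) (g := g) (ae_of_all _ hf0) (ae_of_all _ hg0) (by simpa using hf) (by simpa using hg)
  simp only [Real.rpow_two, ← Real.sqrt_eq_rpow] at h
  have h0 : 0 ≤ ∫ x, f x * g x := integral_nonneg fun x => mul_nonneg (hf0 x) (hg0 x)
  calc _ ≤ (√(∫ x, f x ^ 2) * √(∫ x, g x ^ 2))^2 := by gcongr
    _ = _ := by
      rw [mul_pow, Real.sq_sqrt (integral_nonneg fun x => sq_nonneg _),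
        Real.sq_sqrt (integral_nonneg fun x => sq_nonneg _)]

lemma gn_core (p : ℝ) (hp : 1 < p) (u : SchwartzMap ℝ ℂ) (x0 : ℝ)
    (hmax : ∀ x, ‖u x‖ ≤ ‖u x0‖) :
    (2 * gnPhi p ‖u x0‖ (‖u x0‖^2))^2 ≤ (∫ x : ℝ, ‖deriv (⇑u) x‖ ^ 2) *
      (‖u x0‖ ^ (p-1) * (∫ x : ℝ, ‖u x‖ ^ 2) - ∫ x : ℝ, ‖u x‖ ^ (p + 1)) := by
  set m := ‖u x0‖ with hm
  have hm0 : 0 ≤ m := norm_nonneg _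
  let v := SchwartzMap.derivCLM ℝ ℂ u
  have hv : ∀ x, v x = deriv (⇑u) x := fun x => SchwartzMap.derivCLM_apply ℝ u x
  have hu2 : MemLp (fun x => ‖u x‖) 2 := (u.memLp 2).norm
  have hv2 : MemLp (fun x => ‖deriv (⇑u) x‖) 2 := by
    have := (v.memLp 2).norm
    simpa only [hv] using this
  have hui : Integrable (fun x => ‖u x‖^2) := hu2.integrable_sq
  have hpow : ∀ x, ‖u x‖ ^ (p+1) = ‖u x‖^2 * ‖u x‖ ^ (p-1) := by
    intro x
    rcases (norm_nonneg (u x)).eq_or_lt with h | h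
    · rw [← h, Real.zero_rpow (by linarith)]; simp
    · rw [← Real.rpow_natCast _ 2, ← Real.rpow_add h]; congr 1; push_cast; ring
  have hle : ∀ x, ‖u x‖ ^ (p-1) ≤ m ^ (p-1) := fun x =>
    Real.rpow_le_rpow (norm_nonneg _) (hmax x) (by linarith)
  have hpc : Continuous (fun x => ‖u x‖ ^ (p-1)) :=
    (Real.continuous_rpow_const (by linarith)).comp u.continuous.norm
  have hpi : Integrable (fun x => ‖u x‖ ^ (p+1)) := by
    refine (hui.mul_const (m ^ (p-1))).mono' ?_ (ae_of_all _ fun x => ?_)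
    · exact ((Real.continuous_rpow_const (by linarith)).comp u.continuous.norm).aestronglyMeasurable
    · rw [Real.norm_of_nonneg (by positivity), hpow]
      exact mul_le_mul_of_nonneg_left (hle x) (sq_nonneg _)
  set g : ℝ → ℝ := fun x => ‖u x‖ * √(m ^ (p-1) - ‖u x‖ ^ (p-1)) with hg
  have hgc : Continuous g := by
    have := u.continuous
    fun_prop
  have hgsq : ∀ x, g x ^ 2 = m ^ (p-1) * ‖u x‖^2 - ‖u x‖ ^ (p+1) := by
    intro x
    rw [hg]; simp only
    rw [mul_pow, Real.sq_sqrt (by linarith [hle x]), hpow]; ring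
  have hg2 : MemLp g 2 := by
    rw [memLp_two_iff_integrable_sq hgc.aestronglyMeasurable]
    simp only [hgsq]
    exact (hui.const_mul _).sub hpi
  have hg0 : ∀ x, 0 ≤ g x := fun x => by positivity
  have hcs := gn_cs _ g (fun x => norm_nonneg _) hg0 hv2 hg2
  simp only [hgsq] at hcs
  rw [integral_sub (hui.const_mul _) hpi, integral_const_mul] at hcs
  refine le_trans ?_ hcs
  have hint : Integrable (fun x => ‖deriv (⇑u) x‖ * g x) := hv2.integrable_mul hg2
  have hPhi0 : 0 ≤ gnPhi p m (m^2) := by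
    unfold gnPhi
    exact intervalIntegral.integral_nonneg (by positivity) (fun x _ => by positivity)
  refine pow_le_pow_left₀ (by positivity) ?_ 2
  -- FTC
  set F : ℝ → ℝ := fun x => gnPhi p m (‖u x‖^2) with hF
  set F' : ℝ → ℝ := fun x => √(m ^ (p-1) - ‖u x‖ ^ (p-1)) * inner ℝ (u x) (deriv (⇑u) x) with hF'
  have hd : ∀ x, HasDerivAt F (F' x) x := by
    intro x
    have h1 := (u.differentiableAt (x := x)).hasDerivAt.norm_sq
    have h2 := (gnPhi_hasDerivAt p m hp (‖u x‖^2)).comp x h1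
    have h3 : (‖u x‖^2) ^ ((p-1)/2) = ‖u x‖ ^ (p-1) := by
      rw [← Real.rpow_natCast, ← Real.rpow_mul (norm_nonneg _)]; congr 1; push_cast; ring
    rw [h3] at h2
    refine HasDerivAt.congr_deriv h2 ?_
    simp only [hF']; ring
  have hFle : ∀ x, |F' x| ≤ ‖deriv (⇑u) x‖ * g x := by
    intro x
    simp only [hF', hg, abs_mul, abs_of_nonneg (Real.sqrt_nonneg _)]
    have := abs_real_inner_le_norm (u x) (deriv (⇑u) x)
    calc _ ≤ √(m ^ (p-1) - ‖u x‖ ^ (p-1)) * (‖u x‖ * ‖deriv (⇑u) x‖) := by gcongr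
      _ = _ := by ring
  have hF'c : Continuous F' := by
    have h1 := u.continuous
    have h2 : Continuous (deriv (⇑u)) := by
      have : (⇑v) = deriv (⇑u) := funext hv
      rw [← this]; exact v.continuous
    fun_prop
  have hF'i : Integrable F' := hint.mono' hF'c.aestronglyMeasurable (ae_of_all _ hFle)
  have hlim : Tendsto F (cocompact ℝ) (𝓝 0) := by
    have h1 : Tendsto (fun x => ‖u x‖^2) (cocompact ℝ) (𝓝 0) := by
      simpa using (u.tendsto_cocompact.norm.pow 2)
    have h2 := (gnPhi_hasDerivAt p m hp 0).continuousAt.tendsto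
    rw [gnPhi_zero] at h2
    exact h2.comp h1
  have i1 := integral_Iic_of_hasDerivAt_of_tendsto' (a := x0) (fun x _ => hd x) hF'i.integrableOn
    (hlim.mono_left atBot_le_cocompact)
  have i2 := integral_Ioi_of_hasDerivAt_of_tendsto' (a := x0) (fun x _ => hd x) hF'i.integrableOn
    (hlim.mono_left atTop_le_cocompact)
  have j1 : ∫ x in Iic x0, F' x ≤ ∫ x in Iic x0, ‖deriv (⇑u) x‖ * g x :=
    integral_mono hF'i.integrableOn hint.integrableOn fun x => (le_abs_self _).trans (hFle x)
  have j2 : ∫ x in Ioi x0, -F' x ≤ ∫ x in Ioi x0, ‖deriv (⇑u) x‖ * g x :=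
    integral_mono hF'i.neg.integrableOn hint.integrableOn fun x => (neg_le_abs _).trans (hFle x)
  rw [integral_neg, i2] at j2
  rw [i1] at j1
  have := intervalIntegral.integral_Iic_add_Ioi (b := x0) hint.integrableOn hint.integrableOn
  have hFx : F x0 = gnPhi p m (m^2) := rfl
  linarith

lemma gn_young (p a b t d : ℝ) (hp : 1 < p) (ha : 0 < a) (hb : 0 ≤ b) (ht : 0 < t)
    (h : d ≤ (p+3)/4 * (t ^ (p-1) * b) - (p-1)/4 * (t ^ (p+3) / a)) :
    d ≤ b ^ ((p+3)/4) * a ^ ((p-1)/4) := by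
  have hY := Real.geom_mean_le_arith_mean2_weighted (w₁ := 4/(p+3)) (w₂ := (p-1)/(p+3))
    (p₁ := b ^ ((p+3)/4) * a ^ ((p-1)/4)) (p₂ := t ^ (p+3) / a)
    (by apply div_nonneg <;> linarith) (by apply div_nonneg <;> linarith) (by positivity)
    (by positivity) (by field_simp; ring)
  have e : (b ^ ((p+3)/4) * a ^ ((p-1)/4)) ^ (4/(p+3)) * (t ^ (p+3) / a) ^ ((p-1)/(p+3))
      = t ^ (p-1) * b := by
    have hp3 : p + 3 ≠ 0 := by linarith
    rw [Real.mul_rpow (by positivity) (by positivity), Real.div_rpow (by positivity) ha.le,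
      ← Real.rpow_mul hb, ← Real.rpow_mul ha.le, ← Real.rpow_mul ht.le]
    rw [show (p+3)/4*(4/(p+3)) = 1 by field_simp, show (p-1)/4*(4/(p+3)) = (p-1)/(p+3) by field_simp,
      show (p+3)*((p-1)/(p+3)) = p-1 by field_simp, Real.rpow_one]
    have : a ^ ((p-1)/(p+3)) ≠ 0 := by positivity
    field_simp
  rw [e] at hY
  have h3 : 0 < p + 3 := by linarith
  have := mul_le_mul_of_nonneg_left hY (show 0 ≤ (p+3)/4 by linarith)
  have e2 : (p+3)/4 * (4 / (p + 3) * (b ^ ((p + 3) / 4) * a ^ ((p - 1) / 4)) + (p - 1) / (p + 3) * (t ^ (p + 3) / a))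
    = (b ^ ((p + 3) / 4) * a ^ ((p - 1) / 4)) + (p-1)/4 * (t ^ (p + 3) / a) := by field_simp
  linarith

lemma gn_int (f : ℝ → ℝ) (b C : ℝ) (hb : 0 < b) (hf : Continuous f) (h0 : ∀ x, 0 ≤ f x)
    (h1 : ∀ x, f x ≤ C * Real.exp (-b * x)) (h2 : ∀ x, f x ≤ C * Real.exp (b * x)) :
    Integrable f := by
  rw [← integrableOn_univ, ← Set.Iic_union_Ioi (a := (0:ℝ))]
  refine IntegrableOn.union ?_ ?_
  · refine ((integrableOn_exp_mul_Iic hb 0).const_mul C).mono' hf.aestronglyMeasurable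
      (ae_of_all _ fun x => ?_)
    rw [Real.norm_of_nonneg (h0 x)]; exact h2 x
  · refine ((integrableOn_exp_mul_Ioi (neg_lt_zero.2 hb) 0).const_mul C).mono' hf.aestronglyMeasurable
      (ae_of_all _ fun x => ?_)
    rw [Real.norm_of_nonneg (h0 x)]; exact h1 x

lemma gn_tanh_deriv (x : ℝ) : HasDerivAt Real.tanh (1 - Real.tanh x ^ 2) x := by
  have h : Real.tanh = fun x => Real.sinh x / Real.cosh x := funext Real.tanh_eq_sinh_div_cosh
  have h0 := (Real.cosh_pos x).ne'
  have := (Real.hasDerivAt_sinh x).div (Real.hasDerivAt_cosh x) h0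
  rw [h]
  refine HasDerivAt.congr_deriv this ?_
  field_simp

lemma gn_sech (t : ℝ) : sech t = (Real.cosh t)⁻¹ := by
  rw [sech, Real.cosh_eq, inv_div]

lemma gn_soliton (p μ : ℝ) (hp1 : 1 < p) (hμ : 0 < μ) (Q : ℝ → ℝ)
    (hQ : ∀ x : ℝ,
      Q x = ((p + 1) * μ / 2) ^ ((1 : ℝ) / (p - 1)) *
        sech ((p - 1) * Real.sqrt μ * x / 2) ^ ((2 : ℝ) / (p - 1))) :
    ∃ M S T : ℝ, 0 < M ∧ 0 < T ∧ (∫ x, Q x ^ 2) = S + T ∧ (∫ x, deriv Q x ^ 2) = μ * T ∧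
      (∫ x, Q x ^ (p+1)) = M ^ (p-1) * S ∧ (p-1) * S = 4 * T ∧
      (2 * gnPhi p M (M^2))^2 = μ * T * (M ^ (p-1) * T) := by
  have hq : p - 1 ≠ 0 := by linarith
  have hq0 : 0 < p - 1 := by linarith
  set M := ((p + 1) * μ / 2) ^ ((1 : ℝ) / (p - 1)) with hM
  have hbase : 0 < (p + 1) * μ / 2 := by
    have : 0 < p + 1 := by linarith
    positivity
  have hM0 : 0 < M := Real.rpow_pos_of_pos hbase _
  set s := √μ with hs
  have hs0 : 0 < s := Real.sqrt_pos.2 hμ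
  have hs2 : s^2 = μ := Real.sq_sqrt hμ.le
  set c := (p-1) * s / 2 with hc
  have hc0 : 0 < c := by positivity
  set r := 2/(p-1) with hr
  have hr0 : 0 < r := by positivity
  have hrc : r * c = s := by rw [hr, hc]; field_simp
  have hQc : ∀ x, Q x = M * Real.cosh (c * x) ^ (-r) := by
    intro x
    rw [hQ x, gn_sech, Real.inv_rpow (Real.cosh_pos _).le, ← Real.rpow_neg (Real.cosh_pos _).le]
    congr 3; rw [hc]; ring
  set th : ℝ → ℝ := fun x => Real.tanh (c * x) with hth
  have hthd : ∀ x, HasDerivAt th (c * (1 - th x ^ 2)) x := by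
    intro x
    have h1 : HasDerivAt (fun x => c * x) c x := by simpa using (hasDerivAt_id x).const_mul c
    have := (gn_tanh_deriv (c*x)).comp x h1
    refine HasDerivAt.congr_deriv this ?_
    simp only [hth]; ring
  have hthc : Continuous th := continuous_iff_continuousAt.2 fun x => (hthd x).continuousAt
  have hth1 : ∀ x, th x ^ 2 ≤ 1 := fun x => (Real.tanh_sq_lt_one _).le
  have hth_ch : ∀ x, 1 - th x ^ 2 = (Real.cosh (c*x) ^ 2)⁻¹ := by
    intro x
    have h0 := (Real.cosh_pos (c*x)).ne'
    simp only [hth, Real.tanh_eq_sinh_div_cosh]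
    field_simp
    linarith [Real.cosh_sq (c*x)]
  have hQpos : ∀ x, 0 < Q x := fun x => by
    rw [hQc]; exact mul_pos hM0 (Real.rpow_pos_of_pos (Real.cosh_pos _) _)
  have hQ0 : Q 0 = M := by rw [hQc]; simp
  have hQd : ∀ x, HasDerivAt Q (-s * th x * Q x) x := by
    intro x
    have h1 : HasDerivAt (fun x => c * x) c x := by simpa using (hasDerivAt_id x).const_mul c
    have hch := Real.cosh_pos (c*x)
    have h2 := ((h1.cosh).rpow_const (p := -r) (Or.inl hch.ne')).const_mul M
    have h3 : Q = fun x => M * Real.cosh (c * x) ^ (-r) := funext hQc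
    rw [h3]
    refine HasDerivAt.congr_deriv h2 ?_
    simp only [hth, Real.tanh_eq_sinh_div_cosh, Real.rpow_sub hch, Real.rpow_one]
    rw [← hrc]; ring
  have hQcont : Continuous Q := continuous_iff_continuousAt.2 fun x => (hQd x).continuousAt
  have hQpow : ∀ x, Q x ^ (p-1) = M ^ (p-1) * (1 - th x ^ 2) := by
    intro x
    have hch := Real.cosh_pos (c*x)
    rw [hQc, Real.mul_rpow hM0.le (by positivity), ← Real.rpow_mul hch.le, hth_ch,
      show -r * (p-1) = -(2:ℕ) by rw [hr]; push_cast; field_simp, Real.rpow_neg hch.le,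
      Real.rpow_natCast]
  have hQpow1 : ∀ x, Q x ^ (p+1) = M ^ (p-1) * ((1 - th x ^ 2) * Q x ^ 2) := by
    intro x
    rw [show p + 1 = (p-1) + (2:ℕ) by push_cast; ring, Real.rpow_add (hQpos x), hQpow,
      Real.rpow_natCast]; ring
  have hbd : ∀ x y, y = x ∨ y = -x → Q x ≤ M * 2 ^ r * Real.exp (-s * y) := by
    intro x y hy
    have hch := Real.cosh_pos (c*x)
    have h1 : Real.exp (c * y) / 2 ≤ Real.cosh (c*x) := by
      rw [Real.cosh_eq]
      have := Real.exp_pos (c*x)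
      have := Real.exp_pos (-(c*x))
      rcases hy with rfl | rfl
      · linarith
      · rw [mul_neg]; linarith
    have h2 : Real.cosh (c*x) ^ (-r) ≤ (Real.exp (c * y) / 2) ^ (-r) :=
      Real.rpow_le_rpow_of_nonpos (by positivity) h1 (by linarith)
    have h3 : (Real.exp (c * y) / 2) ^ (-r) = 2 ^ r * Real.exp (-s * y) := by
      rw [Real.div_rpow (by positivity) (by norm_num), ← Real.exp_mul, Real.rpow_neg zero_le_two,
        div_inv_eq_mul, ← hrc, mul_comm]
      congr 2; ring
    rw [hQc, mul_assoc, ← h3]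
    gcongr
  set C := M * 2 ^ r with hC
  have hb1 : ∀ x, Q x ≤ C * Real.exp (-s * x) := fun x => hbd x x (Or.inl rfl)
  have hb2 : ∀ x, Q x ≤ C * Real.exp (s * x) := fun x => by
    simpa using hbd x (-x) (Or.inr rfl)
  have hQM : ∀ x, Q x ≤ M := by
    intro x
    rw [hQc]
    have := Real.rpow_le_one_of_one_le_of_nonpos (Real.one_le_cosh (c*x)) (by linarith : -r ≤ 0)
    nlinarith
  have hI : Integrable (fun x => Q x ^ 2) := by
    refine gn_int _ s (M * C) hs0 (hQcont.pow 2) (fun x => sq_nonneg _) (fun x => ?_) (fun x => ?_)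
    · rw [sq, mul_assoc]; exact mul_le_mul (hQM x) (hb1 x) (hQpos x).le hM0.le
    · rw [sq, mul_assoc]; exact mul_le_mul (hQM x) (hb2 x) (hQpos x).le hM0.le
  have hTi : Integrable (fun x => th x ^ 2 * Q x ^ 2) := by
    refine hI.mono' ((hthc.pow 2).mul (hQcont.pow 2)).aestronglyMeasurable (ae_of_all _ fun x => ?_)
    rw [Real.norm_of_nonneg (by positivity)]
    nlinarith [hth1 x, sq_nonneg (Q x)]
  have hSi : Integrable (fun x => (1 - th x ^ 2) * Q x ^ 2) := by
    have := hI.sub hTi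
    refine this.congr (ae_of_all _ fun x => ?_)
    simp only [Pi.sub_apply]; ring
  have htop : Tendsto Q atTop (𝓝 0) := by
    refine squeeze_zero (fun x => (hQpos x).le) hb1 ?_
    have : Tendsto (fun x => Real.exp (-s*x)) atTop (𝓝 0) :=
      Real.tendsto_exp_atBot.comp (tendsto_id.const_mul_atTop_of_neg (by linarith))
    simpa using this.const_mul C
  have hbot : Tendsto Q atBot (𝓝 0) := by
    refine squeeze_zero (fun x => (hQpos x).le) hb2 ?_
    have : Tendsto (fun x => Real.exp (s*x)) atBot (𝓝 0) :=
      Real.tendsto_exp_atBot.comp (tendsto_id.const_mul_atBot hs0)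
    simpa using this.const_mul C
  set S := ∫ x, (1 - th x ^ 2) * Q x ^ 2 with hS
  set T := ∫ x, th x ^ 2 * Q x ^ 2 with hT
  -- Pohozaev
  have hPoh : (p-1) * S = 4 * T := by
    have hd : ∀ x, HasDerivAt (fun x => th x * Q x ^ 2)
        (c * ((1 - th x ^ 2) * Q x ^ 2) - 2 * s * (th x ^ 2 * Q x ^ 2)) x := by
      intro x
      refine HasDerivAt.congr_deriv ((hthd x).mul ((hQd x).pow 2)) ?_
      simp; ring
    have hlim : ∀ l : Filter ℝ, Tendsto Q l (𝓝 0) → Tendsto (fun x => th x * Q x ^ 2) l (𝓝 0) := by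
      intro l hl
      have h2 : Tendsto (fun x => Q x ^ 2) l (𝓝 0) := by simpa using hl.pow 2
      refine squeeze_zero_norm (fun x => ?_) h2
      rw [norm_mul, Real.norm_of_nonneg (sq_nonneg (Q x)), Real.norm_eq_abs]
      have := (Real.abs_tanh_lt_one (c*x)).le
      exact mul_le_of_le_one_left (sq_nonneg _) this
    have h := integral_of_hasDerivAt_of_tendsto hd ((hSi.const_mul _).sub (hTi.const_mul _))
      (hlim _ hbot) (hlim _ htop)
    rw [integral_sub (hSi.const_mul _) (hTi.const_mul _), integral_const_mul, integral_const_mul,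
      ← hS, ← hT, hc] at h
    have : s * ((p-1) * S - 4 * T) = 0 := by linarith
    rcases mul_eq_zero.1 this with h | h <;> linarith
  -- Phi
  set K := M ^ ((p-1)/2) with hK
  have hK0 : 0 < K := Real.rpow_pos_of_pos hM0 _
  have hK2 : M ^ (p-1) = K^2 := by
    rw [hK, ← Real.rpow_natCast, ← Real.rpow_mul hM0.le]; congr 1; push_cast; ring
  have hPhi : 2 * gnPhi p M (M^2) = K * s * T := by
    have hd : ∀ x, HasDerivAt (fun x => gnPhi p M (Q x ^ 2)) (-(K * s * (|th x| * th x * Q x ^ 2))) x := by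
      intro x
      have h2 := (gnPhi_hasDerivAt p M hp1 (Q x ^ 2)).comp x ((hQd x).pow 2)
      have h3 : (Q x^2) ^ ((p-1)/2) = Q x ^ (p-1) := by
        rw [← Real.rpow_natCast, ← Real.rpow_mul (hQpos x).le]; congr 1; push_cast; ring
      rw [h3, hQpow, hK2, show K^2 - K^2 * (1 - th x ^ 2) = (K * th x)^2 by ring,
        Real.sqrt_sq_eq_abs, abs_mul, abs_of_pos hK0] at h2
      refine HasDerivAt.congr_deriv h2 ?_
      simp; ring
    have hint : Integrable (fun x => -(K * s * (|th x| * th x * Q x ^ 2))) := by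
      refine (Integrable.const_mul ?_ _).neg
      refine hTi.mono' ((hthc.abs.mul hthc).mul (hQcont.pow 2)).aestronglyMeasurable
        (ae_of_all _ fun x => ?_)
      rw [norm_mul, norm_mul, Real.norm_of_nonneg (sq_nonneg (Q x)), Real.norm_eq_abs, abs_abs,
        Real.norm_eq_abs, abs_mul_abs_self, sq (th x)]
    have hlim : ∀ l : Filter ℝ, Tendsto Q l (𝓝 0) → Tendsto (fun x => gnPhi p M (Q x ^ 2)) l (𝓝 0) := by
      intro l hl
      have h1 : Tendsto (fun x => Q x ^ 2) l (𝓝 0) := by simpa using hl.pow 2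
      have h2 := (gnPhi_hasDerivAt p M hp1 0).continuousAt.tendsto
      rw [gnPhi_zero] at h2
      exact h2.comp h1
    have i1 := integral_Iic_of_hasDerivAt_of_tendsto' (a := 0) (fun x _ => hd x) hint.integrableOn
      (hlim _ hbot)
    have i2 := integral_Ioi_of_hasDerivAt_of_tendsto' (a := 0) (fun x _ => hd x) hint.integrableOn
      (hlim _ htop)
    have k1 : ∫ x in Iic (0:ℝ), -(K * s * (|th x| * th x * Q x ^ 2)) =
        ∫ x in Iic (0:ℝ), K * s * (th x ^ 2 * Q x ^ 2) := by
      refine setIntegral_congr_fun measurableSet_Iic fun x hx => ?_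
      have : th x ≤ 0 := by
        simp only [hth, Real.tanh_eq_sinh_div_cosh]
        exact div_nonpos_of_nonpos_of_nonneg
          (Real.sinh_nonpos_iff.2 (mul_nonpos_of_nonneg_of_nonpos hc0.le hx)) (Real.cosh_pos _).le
      simp only [abs_of_nonpos this]; ring
    have k2 : ∫ x in Ioi (0:ℝ), -(K * s * (|th x| * th x * Q x ^ 2)) =
        ∫ x in Ioi (0:ℝ), -(K * s * (th x ^ 2 * Q x ^ 2)) := by
      refine setIntegral_congr_fun measurableSet_Ioi fun x hx => ?_
      have : 0 ≤ th x := by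
        simp only [hth, Real.tanh_eq_sinh_div_cosh]
        exact div_nonneg
          (Real.sinh_nonneg_iff.2 (mul_nonneg hc0.le (le_of_lt hx))) (Real.cosh_pos _).le
      simp only [abs_of_nonneg this]; ring
    rw [k1] at i1
    rw [k2, integral_neg] at i2
    have := intervalIntegral.integral_Iic_add_Ioi (b := 0) (hTi.const_mul (K*s)).integrableOn
      (hTi.const_mul (K*s)).integrableOn
    have hkey : ∫ x, K * s * (th x ^ 2 * Q x ^ 2) = K * s * T := integral_const_mul _ _
    rw [i1, hkey] at this
    rw [hQ0] at i1 i2 this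
    linarith
  have hTpos : 0 < T := by
    have h1 : 0 < 2 * gnPhi p M (M^2) := by
      rw [gnPhi_scale p M hM0]
      have := gnPhi_pos p hp1
      positivity
    rw [hPhi] at h1
    exact pos_of_mul_pos_right h1 (by positivity)
  refine ⟨M, S, T, hM0, hTpos, ?_, ?_, ?_, hPoh, ?_⟩
  · rw [hS, hT, ← integral_add hSi hTi]
    congr 1; ext x; ring
  · rw [hT, ← integral_const_mul]
    congr 1; ext x
    rw [(hQd x).deriv, ← hs2]; ring
  · rw [hS, ← integral_const_mul]
    congr 1; ext x; exact hQpow1 x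
  · rw [hPhi, hK2, ← hs2]; ring

end gn

theorem soliton_optimizes_gagliardo_nirenberg (p μ : ℝ) (hp1 : 1 < p) (hp5 : p < 5)
    (hμ : 0 < μ) (Q : ℝ → ℝ)
    (hQ : ∀ x : ℝ,
      Q x = ((p + 1) * μ / 2) ^ ((1 : ℝ) / (p - 1)) *
        sech ((p - 1) * Real.sqrt μ * x / 2) ^ ((2 : ℝ) / (p - 1))) :
    ∀ u : SchwartzMap ℝ ℂ,
      (∫ x : ℝ, ‖u x‖ ^ (p + 1))
        ≤ ((∫ x : ℝ, Q x ^ (p + 1)) /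
              ((∫ x : ℝ, Q x ^ 2) ^ ((p + 3) / 4)
                * (∫ x : ℝ, deriv Q x ^ 2) ^ ((p - 1) / 4)))
            * (∫ x : ℝ, ‖u x‖ ^ 2) ^ ((p + 3) / 4)
            * (∫ x : ℝ, ‖deriv (⇑u) x‖ ^ 2) ^ ((p - 1) / 4) := by
  intro u
  obtain ⟨M, S, T, hM, hT, hB, hA, hD, hST, hPhi⟩ := gn_soliton p μ hp1 hμ Q hQ
  have hq : 0 < p - 1 := by linarith
  have hS : S = 4 * T / (p-1) := by field_simp; linarith
  have hS0 : 0 < S := by rw [hS]; positivity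
  rw [hB, hA, hD]
  have hA0 : 0 ≤ ∫ x : ℝ, ‖deriv (⇑u) x‖ ^ 2 := integral_nonneg fun x => sq_nonneg _
  have hB0 : 0 ≤ ∫ x : ℝ, ‖u x‖ ^ 2 := integral_nonneg fun x => sq_nonneg _
  by_cases hu : ∀ x, u x = 0
  · have : (∫ x : ℝ, ‖u x‖ ^ (p + 1)) = 0 := by
      simp [hu, Real.zero_rpow (show p + 1 ≠ 0 by linarith)]
    rw [this]
    positivity
  push Not at hu
  obtain ⟨y, hy⟩ := hu
  have hy0 : 0 < ‖u y‖ := norm_pos_iff.2 hy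
  obtain ⟨x0, hx0⟩ := u.continuous.norm.exists_forall_ge' (x₀ := y) (by
    have := u.tendsto_cocompact.norm
    rw [norm_zero] at this
    filter_upwards [this.eventually (gt_mem_nhds hy0)] with x hx using hx.le)
  have hcore := gn_core p hp1 u x0 hx0
  have hm0 : 0 < ‖u x0‖ := hy0.trans_le (hx0 y)
  set m := ‖u x0‖
  set A := ∫ x : ℝ, ‖deriv (⇑u) x‖ ^ 2
  set B := ∫ x : ℝ, ‖u x‖ ^ 2
  set D := ∫ x : ℝ, ‖u x‖ ^ (p + 1)
  have hPm : (2 * gnPhi p m (m^2))^2 = (m/M) ^ (p+3) * (μ * T * (M ^ (p-1) * T)) := by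
    rw [← hPhi, gnPhi_scale p m hm0, gnPhi_scale p M hM, Real.div_rpow hm0.le hM.le]
    have e : ∀ z : ℝ, 0 < z → z ^ (p+3) = (z ^ ((p+3)/2))^2 := by
      intro z hz
      rw [← Real.rpow_natCast, ← Real.rpow_mul hz.le]; congr 1; push_cast; ring
    rw [e m hm0, e M hM]
    have : M ^ ((p+3)/2) ≠ 0 := by positivity
    field_simp
  rw [hPm] at hcore
  have hApos : 0 < A := by
    rcases hA0.eq_or_lt with h | h
    · rw [← h, zero_mul] at hcore
      have : 0 < (m/M) ^ (p+3) * (μ * T * (M ^ (p-1) * T)) := by positivity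
      linarith
    · exact h
  have hmp : m ^ (p-1) = (m/M) ^ (p-1) * M ^ (p-1) := by
    rw [Real.div_rpow hm0.le hM.le]
    have : M ^ (p-1) ≠ 0 := by positivity
    field_simp
  rw [hmp] at hcore
  set t := m / M
  have ht : 0 < t := by positivity
  have hN : 0 < M ^ (p-1) := by positivity
  set N := M ^ (p-1)
  have hY := gn_young p (A / (μ * T)) (B / (S+T)) t (D / (N * S)) hp1 (by positivity)
    (by positivity) ht (by
      have e1 : (p+3)/4 * (t ^ (p-1) * (B / (S+T))) = t ^ (p-1) * N * B / (N * S) := by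
        have : S + T = (p+3) / 4 * S := by rw [hS]; field_simp; ring
        have h3 : 0 < p + 3 := by linarith
        rw [this]; field_simp
      have e2 : (p-1)/4 * (t ^ (p+3) / (A / (μ * T))) =
          (t ^ (p+3) * (μ * T * (N * T)) / A) / (N * S) := by
        rw [hS]; field_simp
      rw [e1, e2, ← sub_div]
      apply div_le_div_of_nonneg_right _ (by positivity)
      have := (div_le_iff₀' hApos).2 hcore
      linarith)
  rw [div_le_iff₀ (by positivity), Real.div_rpow hB0 (by positivity),
    Real.div_rpow hA0 (by positivity)] at hY
  refine hY.trans (le_of_eq ?_)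
  field_simp
end

section
/- Let p ∈ (1,5) and μ > 0, and let Q : ℝ → ℝ be given by Q(x) = ((p+1)μ/2)^{1/(p−1)} · sech( (p−1)√μ x / 2 )^{2/(p−1)}. Then there exists a constant C₀ > 0 such that for every real-valued even Schwartz function v : ℝ → ℝ with ∫_ℝ v(x) Q(x) dx = 0, one has the coercivity estimate ∫_ℝ (v′(x))² dx − p ∫_ℝ Q(x)^{p−1} v(x)² dx + μ ∫_ℝ v(x)² dx ≥ C₀ ( ∫_ℝ (v′(x))² dx + ∫_ℝ v(x)² dx ). -/
open Real MeasureTheory SchwartzMap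

noncomputable def Tf (c x : ℝ) : ℝ := Real.sinh (c * x) / Real.cosh (c * x)
noncomputable def qf (c s x : ℝ) : ℝ := Real.exp (-s * Real.log (Real.cosh (c * x)))
noncomputable def phif (c s x : ℝ) : ℝ := qf c s x * (1 - c * x * Tf c x)
noncomputable def Pf (c s x : ℝ) : ℝ :=
  -s * c * Tf c x * (1 - c * x * Tf c x) - c * Tf c x - c ^ 2 * x * (1 - Tf c x ^ 2)
noncomputable def Vf (c s x : ℝ) : ℝ := s ^ 2 - (s + 1) * (s + 2) * (1 - Tf c x ^ 2)

lemma sq_cosh (c x : ℝ) : 1 - Tf c x ^ 2 = 1 / Real.cosh (c * x) ^ 2 := by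
  have h := Real.cosh_pos (c * x)
  have h2 := Real.cosh_sq (c * x)
  unfold Tf
  field_simp
  linarith

lemma hasDerivAt_Tf (c x : ℝ) : HasDerivAt (Tf c) (c * (1 - Tf c x ^ 2)) x := by
  have h := Real.cosh_pos (c * x)
  have h1 : HasDerivAt (fun x => c * x) c x := by simpa using (hasDerivAt_id x).const_mul c
  have := h1.sinh.div h1.cosh h.ne'
  refine this.congr_deriv ?_
  unfold Tf
  field_simp

lemma hasDerivAt_qf (c s x : ℝ) : HasDerivAt (qf c s) (-s * c * Tf c x * qf c s x) x := by
  have h := Real.cosh_pos (c * x)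
  have h1 : HasDerivAt (fun x => c * x) c x := by simpa using (hasDerivAt_id x).const_mul c
  have := ((h1.cosh.log h.ne').const_mul (-s)).exp
  refine this.congr_deriv ?_
  unfold Tf qf
  ring

lemma hasDerivAt_phif (c s x : ℝ) : HasDerivAt (phif c s) (qf c s x * Pf c s x) x := by
  have h1 : HasDerivAt (fun x => c * x) c x := by simpa using (hasDerivAt_id x).const_mul c
  have := (hasDerivAt_qf c s x).mul ((h1.mul (hasDerivAt_Tf c x)).const_sub 1)
  refine this.congr_deriv ?_
  simp only [Pi.mul_apply]
  unfold Pf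
  ring

lemma hasDerivAt_phif' (c s x : ℝ) : HasDerivAt (fun x => qf c s x * Pf c s x)
    (c ^ 2 * Vf c s x * phif c s x + 2 * s * c ^ 2 * qf c s x) x := by
  have h1 : HasDerivAt (fun x => c * x) c x := by simpa using (hasDerivAt_id x).const_mul c
  have h2 : HasDerivAt (fun x => c ^ 2 * x) (c ^ 2) x := by
    simpa using (hasDerivAt_id x).const_mul (c ^ 2)
  have hT := hasDerivAt_Tf c x
  have hP : HasDerivAt (Pf c s) _ x :=
    (((hT.const_mul (-s * c)).mul ((h1.mul hT).const_sub 1)).sub (hT.const_mul c)).sub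
      (h2.mul ((hT.pow 2).const_sub 1))
  have := (hasDerivAt_qf c s x).mul hP
  refine this.congr_deriv ?_
  simp only [Pi.mul_apply, Pi.pow_apply]
  unfold Pf phif Vf
  push_cast
  ring

/-- The boundary functional. -/
noncomputable def Ef (c s a : ℝ) (v : ℝ → ℝ) (x : ℝ) : ℝ :=
  2 * a * (v x * (qf c s x * Pf c s x)) - a ^ 2 * (phif c s x * (qf c s x * Pf c s x))
    + a ^ 2 * c ^ 2 * (x * qf c s x ^ 2)

lemma hasDerivAt_Ef (c s a : ℝ) (v : ℝ → ℝ) (x d : ℝ) (hv : HasDerivAt v d x) :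
    HasDerivAt (Ef c s a v)
      (d ^ 2 + c ^ 2 * Vf c s x * v x ^ 2 + 4 * s * c ^ 2 * a * (v x * qf c s x)
       - ((d - a * (qf c s x * Pf c s x)) ^ 2 + c ^ 2 * Vf c s x * (v x - a * phif c s x) ^ 2
         + (2 * s - 1) * a ^ 2 * c ^ 2 * qf c s x ^ 2)) x := by
  have hp' := hasDerivAt_phif' c s x
  have hp := hasDerivAt_phif c s x
  have hq := hasDerivAt_qf c s x
  have : HasDerivAt (Ef c s a v) _ x :=
    (((hv.mul hp').const_mul (2 * a)).sub ((hp.mul hp').const_mul (a ^ 2))).add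
      (((hasDerivAt_id x).mul (hq.pow 2)).const_mul (a ^ 2 * c ^ 2))
  refine this.congr_deriv ?_
  simp only [Pi.mul_apply, Pi.pow_apply, id]
  unfold phif
  push_cast
  ring

lemma one_sub_bound (c x : ℝ) :
    (1 - Tf c x ^ 2) * (1 - c * x * Tf c x) ^ 2 ≤ 4 := by
  have h := Real.cosh_pos (c * x)
  have h0 := sq_cosh c x
  have hT : |Tf c x| ≤ 1 := by
    rw [← sq_le_one_iff_abs_le_one]
    have : 0 ≤ 1 / Real.cosh (c * x) ^ 2 := by positivity
    linarith
  have h1 : |1 - c * x * Tf c x| ≤ 1 + |c * x| := by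
    calc |1 - c * x * Tf c x| ≤ |1| + |c * x * Tf c x| := abs_sub _ _
      _ = 1 + |c * x| * |Tf c x| := by rw [abs_one, abs_mul (c * x)]
      _ ≤ _ := by nlinarith [abs_nonneg (c * x)]
  have h2 : 1 + |c * x| ≤ 2 * Real.cosh (c * x) := by
    rw [← Real.cosh_abs, Real.cosh_eq]
    have := Real.add_one_le_exp |c * x|
    have := Real.exp_pos (-|c * x|)
    linarith
  have h3 : (1 - c * x * Tf c x) ^ 2 ≤ (2 * Real.cosh (c * x)) ^ 2 := by
    rw [← sq_abs]
    exact pow_le_pow_left₀ (abs_nonneg _) (h1.trans h2) 2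
  rw [h0, one_div, inv_mul_le_iff₀ (by positivity)]
  linarith

lemma piece (c s a ε ε' : ℝ) (v v' h h' : ℝ → ℝ) (hv : ∀ x, HasDerivAt v (v' x) x)
    (α β : ℝ) (hαβ : α ≤ β)
    (hh : ∀ x ∈ Set.Icc α β, HasDerivAt h (h' x) x)
    (hle : ∀ x ∈ Set.Icc α β, h' x + h x ^ 2 + c ^ 2 * ε ≤ c ^ 2 * Vf c s x)
    (h0 : 0 ≤ ε') (h1 : 2 * ε' ≤ ε) (h2 : 8 * ε' ≤ 2 * s - 1)
    (hint : IntegrableOn (fun x => v' x ^ 2 + c ^ 2 * Vf c s x * v x ^ 2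
      + 4 * s * c ^ 2 * a * (v x * qf c s x) - c ^ 2 * ε' * ((1 - Tf c x ^ 2) * v x ^ 2))
      (Set.Icc α β)) :
    (Ef c s a v β + h β * (v β - a * phif c s β) ^ 2)
      - (Ef c s a v α + h α * (v α - a * phif c s α) ^ 2)
    ≤ ∫ x in α..β, (v' x ^ 2 + c ^ 2 * Vf c s x * v x ^ 2
      + 4 * s * c ^ 2 * a * (v x * qf c s x) - c ^ 2 * ε' * ((1 - Tf c x ^ 2) * v x ^ 2)) := by
  have hd : ∀ x ∈ Set.Icc α β, HasDerivAt
      (fun x => Ef c s a v x + h x * (v x - a * phif c s x) ^ 2) _ x := fun x hx =>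
    (hasDerivAt_Ef c s a v x (v' x) (hv x)).add
      ((hh x hx).mul (((hv x).sub ((hasDerivAt_phif c s x).const_mul a)).pow 2))
  refine intervalIntegral.sub_le_integral_of_hasDeriv_right_of_le hαβ
    (fun x hx => (hd x hx).continuousAt.continuousWithinAt)
    (fun x hx => (hd x (Set.Ioo_subset_Icc_self hx)).hasDerivWithinAt) hint ?_
  intro x hx
  have hx := hle x (Set.Ioo_subset_Icc_self hx)
  simp only [Pi.sub_apply, Pi.pow_apply]
  push_cast
  have hb := one_sub_bound c x
  have hS : 0 ≤ 1 - Tf c x ^ 2 := by rw [sq_cosh]; positivity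
  have hS1 : 1 - Tf c x ^ 2 ≤ 1 := by linarith [sq_nonneg (Tf c x)]
  have hphi : phif c s x = qf c s x * (1 - c * x * Tf c x) := rfl
  set q := qf c s x
  set w := v x - a * phif c s x with hw
  set S := 1 - Tf c x ^ 2
  have hvw : v x = w + a * phif c s x := by rw [hw]; ring
  have k1 : S * v x ^ 2 ≤ 2 * w ^ 2 + 8 * (a ^ 2 * q ^ 2) := by
    have e1 : v x ^ 2 ≤ 2 * w ^ 2 + 2 * (a * phif c s x) ^ 2 := by
      rw [hvw]; nlinarith [sq_nonneg (w - a * phif c s x)]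
    calc S * v x ^ 2 ≤ S * (2 * w ^ 2 + 2 * (a * phif c s x) ^ 2) :=
          mul_le_mul_of_nonneg_left e1 hS
      _ = S * (2 * w ^ 2) + 2 * (a ^ 2 * q ^ 2) * (S * (1 - c * x * Tf c x) ^ 2) := by
          rw [hphi]; ring
      _ ≤ 1 * (2 * w ^ 2) + 2 * (a ^ 2 * q ^ 2) * 4 := by gcongr
      _ = _ := by ring
  have k2 : c ^ 2 * ε' * (S * v x ^ 2) ≤ c ^ 2 * ε' * (2 * w ^ 2 + 8 * (a ^ 2 * q ^ 2)) :=
    mul_le_mul_of_nonneg_left k1 (by positivity)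
  have k3 : c ^ 2 * w ^ 2 * (2 * ε') ≤ c ^ 2 * w ^ 2 * ε :=
    mul_le_mul_of_nonneg_left h1 (by positivity)
  have k4 : c ^ 2 * (a ^ 2 * q ^ 2) * (8 * ε') ≤ c ^ 2 * (a ^ 2 * q ^ 2) * (2 * s - 1) :=
    mul_le_mul_of_nonneg_left h2 (by positivity)
  have k5 := mul_le_mul_of_nonneg_right hx (sq_nonneg w)
  have k6 := sq_nonneg (v' x - a * (q * Pf c s x) - h x * w)

  rw [pow_one]
  linarith

lemma Tf_nonneg {c x : ℝ} (hc : 0 ≤ c) (hx : 0 ≤ x) : 0 ≤ Tf c x :=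
  div_nonneg (Real.sinh_nonneg_iff.2 (mul_nonneg hc hx)) (Real.cosh_pos _).le

lemma Tf_pos {c x : ℝ} (hc : 0 < c) (hx : 0 < x) : 0 < Tf c x :=
  div_pos (Real.sinh_pos_iff.2 (mul_pos hc hx)) (Real.cosh_pos _)

lemma Tf_lt_one (c x : ℝ) : Tf c x < 1 := by
  unfold Tf
  rw [div_lt_one (Real.cosh_pos _)]
  exact Real.sinh_lt_cosh _

lemma Tf_mono {c : ℝ} (hc : 0 < c) : Monotone (Tf c) := by
  refine monotone_of_hasDerivAt_nonneg (f' := fun x => c * (1 - Tf c x ^ 2))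
    (fun x => hasDerivAt_Tf c x) ?_
  intro x
  simp only [Pi.zero_apply, sq_cosh]
  positivity

lemma tendsto_Tf {c : ℝ} (hc : 0 < c) : Filter.Tendsto (Tf c) Filter.atTop (nhds 1) := by
  have h1 : Filter.Tendsto (fun x => c * x) Filter.atTop Filter.atTop :=
    Filter.tendsto_id.const_mul_atTop hc
  have h2 : Filter.Tendsto (fun x => Real.exp (-(c * x))) Filter.atTop (nhds 0) :=
    Real.tendsto_exp_neg_atTop_nhds_zero.comp h1
  have h3 : Filter.Tendsto (fun x => 1 - Real.exp (-(c * x))) Filter.atTop (nhds 1) := by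
    simpa using h2.const_sub 1
  refine tendsto_of_tendsto_of_tendsto_of_le_of_le h3 tendsto_const_nhds ?_
    (fun x => (Tf_lt_one c x).le)
  intro x
  show 1 - Real.exp (-(c * x)) ≤ Real.sinh (c * x) / Real.cosh (c * x)
  rw [le_div_iff₀ (Real.cosh_pos _)]
  have := Real.cosh_sub_sinh (c * x)
  have := Real.exp_pos (-(c * x))
  have := Real.one_le_cosh (c * x)
  nlinarith

lemma qf_pos (c s x : ℝ) : 0 < qf c s x := Real.exp_pos _

lemma qf_le_one {c s : ℝ} (hs : 0 < s) (x : ℝ) : qf c s x ≤ 1 := by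
  unfold qf
  rw [Real.exp_le_one_iff]
  have := Real.log_nonneg (Real.one_le_cosh (c * x))
  nlinarith

lemma tendsto_xqf {c s : ℝ} (hc : 0 < c) (hs : 0 < s) :
    Filter.Tendsto (fun x => x * qf c s x) Filter.atTop (nhds 0) := by
  have hb : 0 < s * c := mul_pos hs hc
  have h1 : Filter.Tendsto (fun x => (s * c) * x) Filter.atTop Filter.atTop :=
    Filter.tendsto_id.const_mul_atTop hb
  have h2 := ((Real.tendsto_pow_mul_exp_neg_atTop_nhds_zero 1).comp h1).const_mul
    (Real.exp (s * Real.log 2) / (s * c))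
  rw [mul_zero] at h2
  refine tendsto_of_tendsto_of_tendsto_of_le_of_le' tendsto_const_nhds h2 ?_ ?_
  · filter_upwards [Filter.eventually_ge_atTop 0] with x hx
    exact mul_nonneg hx (qf_pos _ _ _).le
  · filter_upwards [Filter.eventually_ge_atTop 0] with x hx
    have e : Real.exp (s * Real.log 2) / (s * c) *
        ((fun x => x ^ 1 * Real.exp (-x)) ∘ fun x => s * c * x) x
        = x * Real.exp (s * Real.log 2 + (-(s * c * x))) := by
      simp only [Function.comp, pow_one, Real.exp_add]
      field_simp
    rw [e]
    refine mul_le_mul_of_nonneg_left ?_ hx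
    unfold qf
    rw [Real.exp_le_exp]
    have : c * x - Real.log 2 ≤ Real.log (Real.cosh (c * x)) := by
      rw [Real.le_log_iff_exp_le (Real.cosh_pos _), Real.exp_sub, Real.exp_log two_pos,
        Real.cosh_eq]
      have := Real.exp_pos (-(c * x))
      linarith
    nlinarith

lemma tendsto_qf {c s : ℝ} (hc : 0 < c) (hs : 0 < s) :
    Filter.Tendsto (qf c s) Filter.atTop (nhds 0) := by
  refine tendsto_of_tendsto_of_tendsto_of_le_of_le' tendsto_const_nhds (tendsto_xqf hc hs) ?_ ?_
  · exact Filter.Eventually.of_forall fun x => (qf_pos _ _ _).le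
  · filter_upwards [Filter.eventually_ge_atTop 1] with x hx
    exact le_mul_of_one_le_left (qf_pos _ _ _).le hx

lemma tendsto_phif {c s : ℝ} (hc : 0 < c) (hs : 0 < s) :
    Filter.Tendsto (phif c s) Filter.atTop (nhds 0) := by
  have := (tendsto_qf hc hs).sub (((tendsto_xqf hc hs).const_mul c).mul (tendsto_Tf hc))
  simp only [mul_zero, zero_mul, sub_zero] at this
  refine this.congr fun x => ?_
  unfold phif; ring

lemma tendsto_qP {c s : ℝ} (hc : 0 < c) (hs : 0 < s) :
    Filter.Tendsto (fun x => qf c s x * Pf c s x) Filter.atTop (nhds 0) := by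
  have hT := tendsto_Tf hc
  have hq := tendsto_qf hc hs
  have := (((hT.mul (tendsto_phif hc hs)).const_mul (-s * c)).sub ((hT.mul hq).const_mul c)).sub
    (((tendsto_xqf hc hs).mul ((hT.pow 2).const_sub 1)).const_mul (c ^ 2))
  simp only [mul_zero, zero_mul, sub_zero] at this
  refine this.congr fun x => ?_
  unfold phif Pf; ring

lemma tendsto_Ef {c s : ℝ} (hc : 0 < c) (hs : 0 < s) (a : ℝ) (v : ℝ → ℝ)
    (hv : Filter.Tendsto v Filter.atTop (nhds 0)) :
    Filter.Tendsto (Ef c s a v) Filter.atTop (nhds 0) := by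
  have hP := tendsto_qP hc hs
  have := (((hv.mul hP).const_mul (2 * a)).sub
    (((tendsto_phif hc hs).mul hP).const_mul (a ^ 2))).add
    (((tendsto_xqf hc hs).mul (tendsto_qf hc hs)).const_mul (a ^ 2 * c ^ 2))
  simp only [mul_zero, add_zero, sub_zero] at this
  refine this.congr fun x => ?_
  unfold Ef; ring

/-- The second Riccati function. -/
noncomputable def hB (c s δ x : ℝ) : ℝ :=
  c * ((1 - Tf c x ^ 2) / Tf c x - s * Tf c x + δ / Tf c x ^ 2)

lemma hasDerivAt_hB {c s δ x : ℝ} (hT0 : Tf c x ≠ 0) : HasDerivAt (hB c s δ)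
    (c ^ 2 * (1 - Tf c x ^ 2) * (-1 / Tf c x ^ 2 - 1 - s - 2 * δ / Tf c x ^ 3)) x := by
  have hT := hasDerivAt_Tf c x
  have : HasDerivAt (hB c s δ) _ x :=
    (((((hT.pow 2).const_sub 1).div hT hT0).sub (hT.const_mul s)).add
      ((hasDerivAt_const x δ).div (hT.pow 2) (pow_ne_zero 2 hT0))).const_mul c
  refine this.congr_deriv ?_
  simp only [Pi.pow_apply]
  push_cast
  field_simp
  ring

lemma half_line (c s : ℝ) (hc : 0 < c) (hs : 1 / 2 < s) :
    ∃ ε' > 0, ∃ x0 > 0, phif c s x0 ≠ 0 ∧ ∀ v v' : ℝ → ℝ, (∀ x, HasDerivAt v (v' x) x) →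
      Filter.Tendsto v Filter.atTop (nhds 0) → ∀ a : ℝ, v x0 = a * phif c s x0 →
      Integrable (fun x => v' x ^ 2 + c ^ 2 * Vf c s x * v x ^ 2
      + 4 * s * c ^ 2 * a * (v x * qf c s x) - c ^ 2 * ε' * ((1 - Tf c x ^ 2) * v x ^ 2)) →
      0 ≤ ∫ x in Set.Ioi 0, (v' x ^ 2 + c ^ 2 * Vf c s x * v x ^ 2
      + 4 * s * c ^ 2 * a * (v x * qf c s x) - c ^ 2 * ε' * ((1 - Tf c x ^ 2) * v x ^ 2)) := by
  have hs0 : 0 < s := by linarith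
  set m : ℝ := c ^ 2 * ((s + 1) * (s + 2) + 1) + 1 with hm
  have hm1 : c + 1/4 ≤ m := by
    have : 0 < c ^ 2 * ((s + 1) * (s + 2)) := by positivity
    nlinarith [sq_nonneg (c - 1/2)]
  have hm0 : 0 < m := by positivity
  set x0 : ℝ := 1 / m with hx0
  have hx0p : 0 < x0 := by positivity
  have hmx0 : m * x0 = 1 := by rw [hx0]; field_simp
  have hcx0 : c * x0 < 1 := by nlinarith
  set T0 := Tf c x0 with hT0
  have hT0p : 0 < T0 := Tf_pos hc hx0p
  have hT01 : T0 < 1 := Tf_lt_one _ _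
  set δ := s * T0 ^ 3 with hδ
  have hδp : 0 < δ := by positivity
  set ε := min 1 (s * δ) with hε
  have hεp : 0 < ε := lt_min one_pos (by positivity)
  have hε1 : ε ≤ 1 := min_le_left _ _
  have hε2 : ε ≤ s * δ := min_le_right _ _
  set ε' := min (ε / 2) ((2 * s - 1) / 8) with hε'
  have hε'p : 0 < ε' := lt_min (by positivity) (by linarith)
  have hε'1 : 2 * ε' ≤ ε := by linarith [min_le_left (ε / 2) ((2 * s - 1) / 8)]
  have hε'2 : 8 * ε' ≤ 2 * s - 1 := by linarith [min_le_right (ε / 2) ((2 * s - 1) / 8)]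
  refine ⟨ε', hε'p, x0, hx0p, ?_, ?_⟩
  · unfold phif
    refine mul_ne_zero (qf_pos _ _ _).ne' ?_
    have : c * x0 * T0 < 1 := by nlinarith [mul_pos hc hx0p]
    linarith
  intro v v' hv hvt a ha hint
  have hw0 : v x0 - a * phif c s x0 = 0 := by rw [ha]; ring
  have pA := piece c s a ε ε' v v' (fun x => -m * x) (fun _ => -m) hv 0 x0 hx0p.le
    (fun x _ => by simpa using (hasDerivAt_id x).const_mul (-m))
    (by
      intro x hx
      have h1 : 0 ≤ m * x := mul_nonneg hm0.le hx.1
      have h2 : m * x ≤ 1 := by rw [← hmx0]; exact mul_le_mul_of_nonneg_left hx.2 hm0.le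
      have h3 : (-m * x) ^ 2 ≤ 1 := by nlinarith
      have h4 : -((s + 1) * (s + 2)) ≤ Vf c s x := by
        unfold Vf
        have : 0 ≤ (s + 1) * (s + 2) * Tf c x ^ 2 := by positivity
        nlinarith [sq_nonneg s]
      have h5 := mul_le_mul_of_nonneg_left h4 (sq_nonneg c)
      have h6 := mul_le_mul_of_nonneg_left hε1 (sq_nonneg c)
      show -m + (-m * x) ^ 2 + c ^ 2 * ε ≤ _
      rw [hm] at h3 ⊢
      linarith)
    hε'p.le hε'1 hε'2 hint.integrableOn
  have hTf0 : Tf c 0 = 0 := by simp [Tf]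
  have hE0 : Ef c s a v 0 = 0 := by simp [Ef, Pf, hTf0]
  rw [hw0, hE0] at pA
  have pB : ∀ R, x0 ≤ R → _ := fun R hR => piece c s a ε ε' v v' (hB c s δ)
    (fun x => c ^ 2 * (1 - Tf c x ^ 2) * (-1 / Tf c x ^ 2 - 1 - s - 2 * δ / Tf c x ^ 3)) hv x0 R hR
    (fun x hx => hasDerivAt_hB (Tf_pos hc (hx0p.trans_le hx.1)).ne')
    (by
      intro x hx
      have hTp : 0 < Tf c x := Tf_pos hc (hx0p.trans_le hx.1)
      have hT1 := Tf_lt_one c x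
      have hTT : T0 ≤ Tf c x := Tf_mono hc hx.1
      have e : c ^ 2 * (1 - Tf c x ^ 2) * (-1 / Tf c x ^ 2 - 1 - s - 2 * δ / Tf c x ^ 3)
          + hB c s δ x ^ 2 = c ^ 2 * (Vf c s x - 2 * s * δ / Tf c x + δ ^ 2 / Tf c x ^ 4) := by
        unfold hB Vf
        field_simp
        ring
      rw [e]
      have h1 : δ ^ 2 / Tf c x ^ 4 ≤ s * δ / Tf c x := by
        rw [div_le_div_iff₀ (by positivity) hTp]
        have h3 : T0 ^ 3 ≤ Tf c x ^ 3 := pow_le_pow_left₀ hT0p.le hTT 3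
        calc δ ^ 2 * Tf c x = s * δ * Tf c x * T0 ^ 3 := by rw [hδ]; ring
          _ ≤ s * δ * Tf c x * Tf c x ^ 3 := by gcongr
          _ = _ := by ring
      have h2 : s * δ ≤ s * δ / Tf c x := by
        rw [le_div_iff₀ hTp]
        nlinarith [mul_pos hs0 hδp]
      have h3 : 2 * s * δ / Tf c x = 2 * (s * δ / Tf c x) := by ring
      rw [← mul_add]
      refine mul_le_mul_of_nonneg_left ?_ (sq_nonneg c)
      linarith)
    hε'p.le hε'1 hε'2 hint.integrableOn
  rw [hw0] at pB
  have hlim := intervalIntegral_tendsto_integral_Ioi 0 hint.integrableOn Filter.tendsto_id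
  have hT := tendsto_Tf hc
  have hhB : Filter.Tendsto (hB c s δ) Filter.atTop
      (nhds (c * ((1 - 1 ^ 2) / 1 - s * 1 + δ / 1 ^ 2))) :=
    (((((hT.pow 2).const_sub 1).div hT one_ne_zero).sub (hT.const_mul s)).add
      ((tendsto_const_nhds).div (hT.pow 2) (by norm_num))).const_mul c
  have hF := (tendsto_Ef hc hs0 a v hvt).add
    (hhB.mul ((hvt.sub ((tendsto_phif hc hs0).const_mul a)).pow 2))
  have hz : (0:ℝ) + c * ((1 - 1 ^ 2) / 1 - s * 1 + δ / 1 ^ 2) * (0 - a * 0) ^ 2 = 0 := by ring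
  rw [hz] at hF
  refine le_of_tendsto_of_tendsto hF hlim ?_
  filter_upwards [Filter.eventually_ge_atTop x0] with R hR
  have := pB R hR
  rw [id, ← intervalIntegral.integral_add_adjacent_intervals (b := x0)
    hint.intervalIntegrable hint.intervalIntegrable]
  linarith

lemma full_line (c s : ℝ) (hc : 0 < c) (hs : 1 / 2 < s) :
    ∃ ε' > 0, ∀ v : SchwartzMap ℝ ℝ, (∀ x : ℝ, v (-x) = v x) →
      (∫ x : ℝ, v x * qf c s x) = 0 →
      c ^ 2 * ε' * (∫ x : ℝ, (1 - Tf c x ^ 2) * v x ^ 2) ≤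
      (∫ x : ℝ, deriv (⇑v) x ^ 2) + c ^ 2 * s ^ 2 * (∫ x : ℝ, v x ^ 2)
        - c ^ 2 * ((s + 1) * (s + 2)) * (∫ x : ℝ, (1 - Tf c x ^ 2) * v x ^ 2) := by
  obtain ⟨ε', hε', x0, hx0, hphi, H⟩ := half_line c s hc hs
  have hs0 : 0 < s := by linarith
  refine ⟨ε', hε', fun v hev horth => ?_⟩
  have hTc : Continuous (Tf c) :=
    continuous_iff_continuousAt.2 fun x => (hasDerivAt_Tf c x).continuousAt
  have hqc : Continuous (qf c s) :=
    continuous_iff_continuousAt.2 fun x => (hasDerivAt_qf c s x).continuousAt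
  have hd : ∀ x, HasDerivAt v (deriv v x) x := fun x => v.differentiableAt.hasDerivAt
  have i1 : Integrable (fun x => deriv (⇑v) x ^ 2) :=
    ((SchwartzMap.derivCLM ℝ ℝ v).memLp 2 volume).integrable_sq
  have i2 : Integrable (fun x => v x ^ 2) := (v.memLp 2 volume).integrable_sq
  have i3 : Integrable (fun x => (1 - Tf c x ^ 2) * v x ^ 2) := by
    refine i2.bdd_mul (c := 1) (by fun_prop) (Filter.Eventually.of_forall fun x => ?_)
    have : 0 ≤ 1 - Tf c x ^ 2 := by rw [sq_cosh]; positivity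
    rw [Real.norm_of_nonneg this]
    linarith [sq_nonneg (Tf c x)]
  have i4 : Integrable (fun x => v x * qf c s x) := by
    refine (v.integrable (μ := volume)).mul_bdd (c := 1) (by fun_prop)
      (Filter.Eventually.of_forall fun x => ?_)
    rw [Real.norm_of_nonneg (qf_pos _ _ _).le]
    exact qf_le_one hs0 x
  set a := v x0 / phif c s x0 with ha
  have hva : v x0 = a * phif c s x0 := by rw [ha]; field_simp
  have hvt : Filter.Tendsto v Filter.atTop (nhds 0) :=
    v.tendsto_cocompact.mono_left atTop_le_cocompact
  set f : ℝ → ℝ := fun x => deriv v x ^ 2 + c ^ 2 * Vf c s x * v x ^ 2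
      + 4 * s * c ^ 2 * a * (v x * qf c s x) - c ^ 2 * ε' * ((1 - Tf c x ^ 2) * v x ^ 2) with hf
  have hfe : f = fun x => ((deriv v x ^ 2 + c ^ 2 * s ^ 2 * v x ^ 2)
      + 4 * s * c ^ 2 * a * (v x * qf c s x))
      - (c ^ 2 * ((s + 1) * (s + 2)) + c ^ 2 * ε') * ((1 - Tf c x ^ 2) * v x ^ 2) := by
    funext x; simp only [hf, Vf]; ring
  have j12 : Integrable (fun x => deriv v x ^ 2 + c ^ 2 * s ^ 2 * v x ^ 2) :=
    i1.add (i2.const_mul (c ^ 2 * s ^ 2))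
  have j4 := i4.const_mul (4 * s * c ^ 2 * a)
  have j124 : Integrable (fun x => (deriv v x ^ 2 + c ^ 2 * s ^ 2 * v x ^ 2)
      + 4 * s * c ^ 2 * a * (v x * qf c s x)) := j12.add j4
  have j3 := i3.const_mul (c ^ 2 * ((s + 1) * (s + 2)) + c ^ 2 * ε')
  have hfi : Integrable f := by
    rw [hfe]; exact (j12.add j4).sub j3
  have h0 := H v (deriv v) hd hvt a hva hfi
  have hTo : ∀ x, Tf c (-x) = -Tf c x := fun x => by
    simp [Tf, neg_div]
  have hde : ∀ x, deriv v (-x) = -deriv v x := fun x => by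
    have h1 := deriv_comp_neg (f := v) x
    have h2 : (fun x => v (-x)) = v := funext hev
    rw [h2] at h1
    linarith
  have hqe : ∀ x, qf c s (-x) = qf c s x := fun x => by simp [qf]
  have hfev : ∀ x, f (-x) = f x := fun x => by
    simp only [hf, Vf, hTo, hde, hqe, hev, neg_sq]
  have hfabs : ∀ x, f |x| = f x := fun x => by
    rcases abs_choice x with h | h <;> rw [h]
    exact hfev x
  have h1 : 0 ≤ ∫ x, f x := by
    have := integral_comp_abs (f := f)
    simp only [hfabs] at this
    rw [this]
    exact mul_nonneg two_pos.le h0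
  have h2 : ∫ x, f x = ((∫ x, deriv v x ^ 2) + c ^ 2 * s ^ 2 * (∫ x, v x ^ 2)
      + 4 * s * c ^ 2 * a * (∫ x, v x * qf c s x))
      - (c ^ 2 * ((s + 1) * (s + 2)) + c ^ 2 * ε') * (∫ x, (1 - Tf c x ^ 2) * v x ^ 2) := by
    rw [hfe, integral_sub j124 j3, integral_add j12 j4,
      integral_add i1 (i2.const_mul (c ^ 2 * s ^ 2))]
    simp only [integral_const_mul]
  rw [h2, horth] at h1
  linarith

theorem coercivity_of_linearized_operator (p μ : ℝ) (hp1 : 1 < p) (hp5 : p < 5)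
    (hμ : 0 < μ) (Q : ℝ → ℝ)
    (hQ : ∀ x : ℝ,
      Q x = ((p + 1) * μ / 2) ^ ((1 : ℝ) / (p - 1)) *
        sech ((p - 1) * Real.sqrt μ * x / 2) ^ ((2 : ℝ) / (p - 1))) :
    ∃ C₀ : ℝ, 0 < C₀ ∧
      ∀ v : SchwartzMap ℝ ℝ, (∀ x : ℝ, v (-x) = v x) →
        (∫ x : ℝ, v x * Q x) = 0 →
        C₀ * ((∫ x : ℝ, deriv (⇑v) x ^ 2) + ∫ x : ℝ, v x ^ 2)
          ≤ (∫ x : ℝ, deriv (⇑v) x ^ 2) - p * (∫ x : ℝ, Q x ^ (p - 1) * v x ^ 2)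
              + μ * ∫ x : ℝ, v x ^ 2 := by
  have hp : 0 < p - 1 := by linarith
  set c := (p - 1) * Real.sqrt μ / 2 with hc
  set s := 2 / (p - 1) with hs
  have hcp : 0 < c := by positivity
  have hsp : 1 / 2 < s := by
    rw [hs, div_lt_div_iff₀ two_pos hp]; linarith
  have hcs : c ^ 2 * s ^ 2 = μ := by
    rw [hc, hs]; field_simp; rw [Real.sq_sqrt hμ.le]
  have hpp : p * ((p + 1) * μ / 2) = c ^ 2 * ((s + 1) * (s + 2)) := by
    have : c ^ 2 * ((s + 1) * (s + 2)) = (c ^ 2 * s ^ 2) * ((1 + 1 / s) * (1 + 2 / s)) := by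
      have : s ≠ 0 := by linarith
      field_simp
    rw [this, hcs, hs]; field_simp; ring
  have hsech : ∀ x, sech ((p - 1) * Real.sqrt μ * x / 2) = (Real.cosh (c * x))⁻¹ := fun x => by
    have : (p - 1) * Real.sqrt μ * x / 2 = c * x := by rw [hc]; ring
    rw [this, sech, Real.cosh_eq, inv_div]
  have hB : 0 < (p + 1) * μ / 2 := by have : 0 < p + 1 := by linarith
                                      positivity
  set A := ((p + 1) * μ / 2) ^ ((1 : ℝ) / (p - 1)) with hA
  have hAp : 0 < A := Real.rpow_pos_of_pos hB _
  have hQ1 : ∀ x, Q x = A * qf c s x := fun x => by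
    rw [hQ, hsech]
    congr 1
    rw [Real.rpow_def_of_pos (inv_pos.2 (Real.cosh_pos _)), Real.log_inv, qf]
    congr 1; ring
  have hQ2 : ∀ x, Q x ^ (p - 1) = (p + 1) * μ / 2 * (1 - Tf c x ^ 2) := fun x => by
    have hi := inv_pos.2 (Real.cosh_pos (c * x))
    rw [hQ, hsech, Real.mul_rpow hAp.le (Real.rpow_nonneg hi.le _), hA,
      ← Real.rpow_mul hB.le, ← Real.rpow_mul hi.le, sq_cosh]
    have e1 : 1 / (p - 1) * (p - 1) = 1 := by field_simp
    have e2 : s * (p - 1) = (2 : ℕ) := by rw [hs]; push_cast; field_simp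
    rw [e1, e2, Real.rpow_one, Real.rpow_natCast, one_div, inv_pow]
  obtain ⟨ε', hε', H⟩ := full_line c s hcp hsp
  set K := c ^ 2 * ((s + 1) * (s + 2)) with hK
  have hKp : 0 < K := by positivity
  set e := c ^ 2 * ε' with he
  have hep : 0 < e := by positivity
  refine ⟨min 1 μ * (e / (K + e)), by have := lt_min one_pos hμ; positivity, ?_⟩
  intro v hev horth
  have ho : (∫ x : ℝ, v x * qf c s x) = 0 := by
    have : ∀ x, v x * Q x = A * (v x * qf c s x) := fun x => by rw [hQ1]; ring
    simp only [this, integral_const_mul] at horth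
    exact (mul_eq_zero.1 horth).resolve_left hAp.ne'
  have h := H v hev ho
  have hD : p * (∫ x : ℝ, Q x ^ (p - 1) * v x ^ 2)
      = K * ∫ x : ℝ, (1 - Tf c x ^ 2) * v x ^ 2 := by
    simp only [hQ2, mul_assoc ((p + 1) * μ / 2), integral_const_mul]
    rw [← mul_assoc, hpp]
  rw [hD]
  rw [hcs] at h
  have a0 : 0 ≤ ∫ x : ℝ, deriv (⇑v) x ^ 2 := integral_nonneg fun x => sq_nonneg _
  have b0 : 0 ≤ ∫ x : ℝ, v x ^ 2 := integral_nonneg fun x => sq_nonneg _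
  generalize (∫ x : ℝ, deriv (⇑v) x ^ 2) = X at *
  generalize (∫ x : ℝ, v x ^ 2) = Y at *
  generalize (∫ x : ℝ, (1 - Tf c x ^ 2) * v x ^ 2) = D at *
  have g1 : min 1 μ * (X + Y) ≤ X + μ * Y := by
    have := mul_le_mul_of_nonneg_right (min_le_left 1 μ) a0
    have := mul_le_mul_of_nonneg_right (min_le_right 1 μ) b0
    linarith
  have g2 : e / (K + e) * (X + μ * Y) ≤ X - K * D + μ * Y := by
    rw [div_mul_eq_mul_div, div_le_iff₀ (by positivity)]
    nlinarith
  have g3 := mul_le_mul_of_nonneg_left g1 (show 0 ≤ e / (K + e) by positivity)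
  linarith
end
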